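/- arXiv:2201.09465 — 2 statements merged into one kernel-verified Lean document; each statement's English description precedes it below -/
import Mathlib

section
/- For all positive integers m and n, cr(K_{1,1,m,n}) ≤ Z(m+2,n+2) − mn + ⌊m/2⌋⌊n/2⌋. -/
open SimpleGraph

variable {V : Type*}

/-- A drawing of a simple graph in the plane: an injective placement of the
vertices in `ℝ²` together with, for each edge, a continuous arc joining the
positions of its endpoints (parametrised compatibly in both directions),
such that no arc passes through the position of a vertex other than its
endpoints. -/
structure Drawing (G : SimpleGraph V) where
  pos : V → ℝ × ℝ
  pos_inj : Function.Injective pos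
  arc : V → V → ℝ → ℝ × ℝ
  arc_cont : ∀ ⦃a b⦄, G.Adj a b → ContinuousOn (arc a b) (Set.Icc 0 1)
  arc_zero : ∀ ⦃a b⦄, G.Adj a b → arc a b 0 = pos a
  arc_one : ∀ ⦃a b⦄, G.Adj a b → arc a b 1 = pos b
  arc_symm : ∀ ⦃a b⦄, G.Adj a b → ∀ t, arc b a t = arc a b (1 - t)
  arc_avoid : ∀ ⦃a b⦄, G.Adj a b → ∀ c, c ≠ a → c ≠ b →
      pos c ∉ arc a b '' Set.Icc 0 1

namespace Drawing

variable {G : SimpleGraph V} (D : Drawing G)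

/-- The set of points of the plane used by the edge `e`. -/
def edgePoints (e : Sym2 V) : Set (ℝ × ℝ) :=
  {p | ∃ a b, e = s(a, b) ∧ G.Adj a b ∧ p ∈ D.arc a b '' Set.Icc 0 1}

/-- The positions of the endpoints of an edge. -/
def ends (e : Sym2 V) : Set (ℝ × ℝ) := {p | ∃ a ∈ e, p = D.pos a}

/-- `p` is a crossing of the (distinct) edges `e` and `f` in the drawing `D`:
a common point of the two edges other than an endpoint. -/
def IsCrossing (e f : Sym2 V) (p : ℝ × ℝ) : Prop :=
  e ∈ G.edgeSet ∧ f ∈ G.edgeSet ∧ e ≠ f ∧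
    p ∈ D.edgePoints e ∧ p ∈ D.edgePoints f ∧ p ∉ D.ends e ∧ p ∉ D.ends f

/-- The crossings between an edge of `A` and an edge of `B`: a crossing is
recorded as a point of the plane together with the unordered pair of edges
crossing there. -/
def crossings (A B : Set (Sym2 V)) : Set ((ℝ × ℝ) × Sym2 (Sym2 V)) :=
  {q | ∃ e f, q.2 = s(e, f) ∧ e ∈ A ∧ f ∈ B ∧ D.IsCrossing e f q.1}

/-- `cr_D(A, B)`: the number of crossings between an edge of `A` and an
edge of `B`. -/
noncomputable def crBetween (A B : Set (Sym2 V)) : ℕ := Nat.card (D.crossings A B)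

/-- `cr(D)`: the total number of crossings of the drawing `D`. -/
noncomputable def crNum : ℕ := D.crBetween G.edgeSet G.edgeSet

/-- A good drawing: no edge crosses itself (each arc is a simple arc),
no two adjacent edges cross, no two edges cross more than once, and no three
edges cross at a common point. -/
structure IsGood : Prop where
  arc_inj : ∀ ⦃a b⦄, G.Adj a b → Set.InjOn (D.arc a b) (Set.Icc 0 1)
  adj_no_cross : ∀ e f : Sym2 V, (∃ a, a ∈ e ∧ a ∈ f) → ∀ p, ¬ D.IsCrossing e f p
  cross_once : ∀ e f : Sym2 V, {p | D.IsCrossing e f p}.Subsingleton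
  no_triple : ∀ p, ∀ e f g : Sym2 V, e ≠ f → e ≠ g → f ≠ g →
      ¬ (D.IsCrossing e f p ∧ D.IsCrossing f g p ∧ D.IsCrossing e g p)

end Drawing

/-- The crossing number of a graph: the minimum number of crossings among
all good drawings of `G` in the plane. -/
noncomputable def crossingNumber (G : SimpleGraph V) : ℕ :=
  sInf {n | ∃ D : Drawing G, D.IsGood ∧ D.crNum = n}

/-- The Zarankiewicz function `Z(m,n) = ⌊m/2⌋⌊(m-1)/2⌋⌊n/2⌋⌊(n-1)/2⌋`. -/
def Z (m n : ℕ) : ℕ := m / 2 * ((m - 1) / 2) * (n / 2) * ((n - 1) / 2)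

/-- The complete bipartite graph `K_{a,b}`. -/
abbrev bipK (a b : ℕ) : SimpleGraph (Fin a ⊕ Fin b) :=
  completeBipartiteGraph (Fin a) (Fin b)

/-- The complete tripartite graph `K_{a,b,c}`. -/
abbrev triK (a b c : ℕ) : SimpleGraph (Σ i : Fin 3, ![Fin a, Fin b, Fin c] i) :=
  completeMultipartiteGraph ![Fin a, Fin b, Fin c]

/-- The complete 4-partite graph `K_{a,b,c,d}`. -/
abbrev quadK (a b c d : ℕ) : SimpleGraph (Σ i : Fin 4, ![Fin a, Fin b, Fin c, Fin d] i) :=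
  completeMultipartiteGraph ![Fin a, Fin b, Fin c, Fin d]

/-- `E(V₁, V₂)`: the set of pairs `{v₁, v₂}` with `v₁ ∈ V₁` and `v₂ ∈ V₂`. -/
def pairEdges {α : Type*} (V₁ V₂ : Set α) : Set (Sym2 α) :=
  {e | ∃ a ∈ V₁, ∃ b ∈ V₂, e = s(a, b)}


/-! ### Planar geometry of segments -/

namespace RectDraw

def InSeg (p u v : ℝ × ℝ) : Prop :=
  ∃ r : ℝ, 0 ≤ r ∧ r ≤ 1 ∧ p.1 = (1 - r) * u.1 + r * v.1 ∧ p.2 = (1 - r) * u.2 + r * v.2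

theorem InSeg.swap {p u v : ℝ × ℝ} (h : InSeg p u v) : InSeg p v u := by
  obtain ⟨r, h0, h1, h2, h3⟩ := h
  exact ⟨1 - r, by linarith, by linarith, by rw [h2]; ring, by rw [h3]; ring⟩

/-- Two segments meet at most at endpoints. -/
def NC (u v w x : ℝ × ℝ) : Prop :=
  ∀ p, InSeg p u v → InSeg p w x → p = u ∨ p = v ∨ p = w ∨ p = x

/-- Two segments meet at most once. -/
def Uniq (u v w x : ℝ × ℝ) : Prop :=
  ∀ p q, InSeg p u v → InSeg p w x → InSeg q u v → InSeg q w x → p = q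

theorem NC.symm {u v w x : ℝ × ℝ} (h : NC u v w x) : NC w x u v := by
  intro p h1 h2
  rcases h p h2 h1 with h | h | h | h <;> simp [h]

theorem NC.flip {u v w x : ℝ × ℝ} (h : NC u v w x) : NC v u w x := by
  intro p h1 h2
  rcases h p h1.swap h2 with h | h | h | h <;> simp [h]

theorem Uniq.symm {u v w x : ℝ × ℝ} (h : Uniq u v w x) : Uniq w x u v :=
  fun p q h1 h2 h3 h4 => h p q h2 h1 h4 h3

theorem Uniq.flip {u v w x : ℝ × ℝ} (h : Uniq u v w x) : Uniq v u w x :=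
  fun p q h1 h2 h3 h4 => h p q h1.swap h2 h3.swap h4

def lin (α β γ : ℝ) (p : ℝ × ℝ) : ℝ := α * p.1 + β * p.2 + γ

theorem nc_of_lin (α β γ : ℝ) {u v w x : ℝ × ℝ} (hu : 0 ≤ lin α β γ u) (hv : 0 ≤ lin α β γ v)
    (huv : 0 < lin α β γ u + lin α β γ v) (hw : lin α β γ w ≤ 0) (hx : lin α β γ x ≤ 0) :
    NC u v w x := by
  rintro p ⟨r, h0, h1, h2, h3⟩ ⟨q, g0, g1, g2, g3⟩
  have e1 : lin α β γ p = (1 - r) * lin α β γ u + r * lin α β γ v := by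
    simp only [lin, h2, h3]; ring
  have e2 : lin α β γ p = (1 - q) * lin α β γ w + q * lin α β γ x := by
    simp only [lin, g2, g3]; ring
  have n1 : 0 ≤ (1 - r) * lin α β γ u := mul_nonneg (by linarith) hu
  have n2 : 0 ≤ r * lin α β γ v := mul_nonneg h0 hv
  have n3 : (1 - q) * lin α β γ w ≤ 0 := mul_nonpos_of_nonneg_of_nonpos (by linarith) hw
  have n4 : q * lin α β γ x ≤ 0 := mul_nonpos_of_nonneg_of_nonpos g0 hx
  have z1 : (1 - r) * lin α β γ u = 0 := by linarith
  have z2 : r * lin α β γ v = 0 := by linarith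
  rcases mul_eq_zero.1 z1 with h | h
  · right; left
    have : r = 1 := by linarith
    subst this
    ext <;> simp [h2, h3]
  · rcases mul_eq_zero.1 z2 with h' | h'
    · left
      subst h'
      ext <;> simp [h2, h3]
    · linarith

def orient (u v w : ℝ × ℝ) : ℝ :=
  (v.1 - u.1) * (w.2 - u.2) - (v.2 - u.2) * (w.1 - u.1)

theorem orient_eq (u v w : ℝ × ℝ) :
    orient u v w = lin (-(v.2 - u.2)) (v.1 - u.1)
      ((v.2 - u.2) * u.1 - (v.1 - u.1) * u.2) w := by
  simp only [orient, lin]; ring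

/-- segment `w x` weakly on the positive side of line `u v`, touching it at most once. -/
theorem nc_pos {u v w x : ℝ × ℝ} (hw : 0 ≤ orient u v w) (hx : 0 ≤ orient u v x)
    (h : 0 < orient u v w + orient u v x) : NC u v w x := by
  rw [orient_eq] at hw hx h
  rw [orient_eq] at h
  refine (nc_of_lin _ _ _ hw hx h ?_ ?_).symm
  · simp only [lin]; apply le_of_eq; ring
  · simp only [lin]; apply le_of_eq; ring

theorem nc_neg {u v w x : ℝ × ℝ} (hw : orient u v w ≤ 0) (hx : orient u v x ≤ 0)
    (h : orient u v w + orient u v x < 0) : NC u v w x := by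
  have e : ∀ z, orient v u z = - orient u v z := by intro z; simp only [orient]; ring
  refine NC.flip (nc_pos ?_ ?_ ?_) <;> simp only [e] <;> linarith

theorem uniq_of_orient {u v w x : ℝ × ℝ} (hw : orient u v w ≠ 0) : Uniq u v w x := by
  rintro p p' ⟨r, h0, h1, h2, h3⟩ ⟨q, g0, g1, g2, g3⟩ ⟨r', h0', h1', h2', h3'⟩
    ⟨q', g0', g1', g2', g3'⟩
  have e1 : orient u v p = 0 := by simp only [orient, h2, h3]; ring
  have e2 : orient u v p' = 0 := by simp only [orient, h2', h3']; ring
  have f1 : orient u v p = (1 - q) * orient u v w + q * orient u v x := by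
    simp only [orient, g2, g3]; ring
  have f2 : orient u v p' = (1 - q') * orient u v w + q' * orient u v x := by
    simp only [orient, g2', g3']; ring
  have : (q' - q) * orient u v w = 0 := by
    have : (q' - q) * orient u v w = q' * orient u v p - q * orient u v p' := by
      rw [f1, f2]; ring
    rw [this, e1, e2]; ring
  rcases mul_eq_zero.1 this with h | h
  · have : q' = q := by linarith
    subst this
    ext
    · rw [g2, g2']
    · rw [g3, g3']
  · exact absurd h hw

/-- a point strictly off the side of a segment -/
theorem not_inSeg_of_lin (α β γ : ℝ) {c u v : ℝ × ℝ} (hc : 0 < lin α β γ c)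
    (hu : lin α β γ u ≤ 0) (hv : lin α β γ v ≤ 0) : ¬ InSeg c u v := by
  rintro ⟨r, h0, h1, h2, h3⟩
  have e1 : lin α β γ c = (1 - r) * lin α β γ u + r * lin α β γ v := by
    simp only [lin, h2, h3]; ring
  have n3 : (1 - r) * lin α β γ u ≤ 0 := mul_nonpos_of_nonneg_of_nonpos (by linarith) hu
  have n4 : r * lin α β γ v ≤ 0 := mul_nonpos_of_nonneg_of_nonpos h0 hv
  linarith

theorem not_inSeg_of_orient {c u v : ℝ × ℝ} (hc : orient u v c ≠ 0) : ¬ InSeg c u v := by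
  rintro ⟨r, h0, h1, h2, h3⟩
  apply hc
  simp only [orient, h2, h3]; ring

/-- Segments from `w` to two points of a line avoiding `w` meet only in `w`. -/
theorem eq_of_two (α β γ : ℝ) {p w u v : ℝ × ℝ} (hu : lin α β γ u = 0) (hv : lin α β γ v = 0)
    (hw : lin α β γ w ≠ 0) (huv : u ≠ v) (h1 : InSeg p u w) (k2 : InSeg p v w) : p = w := by
  obtain ⟨r, h0, h1, h2, h3⟩ := h1
  obtain ⟨q, g0, g1, g2, g3⟩ := k2
  have e1 : lin α β γ p = (1 - r) * lin α β γ u + r * lin α β γ w := by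
    simp only [lin, h2, h3]; ring
  have e2 : lin α β γ p = (1 - q) * lin α β γ v + q * lin α β γ w := by
    simp only [lin, g2, g3]; ring
  have : (r - q) * lin α β γ w = 0 := by
    rw [hu] at e1; rw [hv] at e2; linarith
  rcases mul_eq_zero.1 this with h | h
  · have : r = q := by linarith
    subst this
    by_cases hr : r = 1
    · subst hr; ext <;> simp [h2, h3]
    · exfalso; apply huv
      have hr' : 1 - r ≠ 0 := fun h => hr (by linarith)
      ext
      · apply mul_left_cancel₀ hr'; linarith
      · apply mul_left_cancel₀ hr'; linarith
  · exact absurd h hw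

/-! ### The configuration -/

inductive Kd | a | b | A | B | C | D

noncomputable instance : DecidableEq Kd := Classical.decEq Kd

open Kd

def P : Kd → ℝ → ℝ × ℝ
  | a, _ => (0, -1)
  | b, _ => (0, 4)
  | A, s => (-(2 + s), -(2 + s))
  | B, s => (2 + s, -(2 + s))
  | C, s => (1 - s, 3 * s)
  | D, s => (-(1 - s), 3 * s)

inductive Ori : Kd → Kd → Prop
  | AB : Ori A B
  | BC : Ori B C
  | CD : Ori C D
  | DA : Ori D A
  | aA : Ori a A
  | aB : Ori a B
  | aC : Ori a C
  | aD : Ori a D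
  | bA : Ori b A
  | bB : Ori b B
  | bC : Ori b C
  | bD : Ori b D
  | ab : Ori a b

def AdjK (k l : Kd) : Prop := Ori k l ∨ Ori l k

abbrev Lab := Kd × ℕ

/-- Strips, with hub `a`, in both orders. -/
inductive StripA : Kd → Kd → Prop
  | AB : StripA A B
  | BA : StripA B A
  | CD : StripA C D
  | DC : StripA D C

inductive StripB : Kd → Kd → Prop
  | BC : StripB B C
  | CB : StripB C B
  | DA : StripB D A
  | AD : StripB A D

inductive Strip : Kd → Kd → Prop
  | AB : Strip A B
  | BC : Strip B C
  | CD : Strip C D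
  | DA : Strip D A

/-- the pairs of edges allowed to cross -/
inductive Alw : Sym2 (Sym2 Lab) → Prop
  | xxyy {X Y : Kd} (h : Strip X Y) {i j k l : ℕ} (hij : j < i) (hkl : l < k) :
      Alw s(s((X, i), (Y, l)), s((X, j), (Y, k)))
  | ax {X Y : Kd} (h : StripA X Y) {i j k o : ℕ} (hij : j < i) :
      Alw s(s((a, o), (X, i)), s((X, j), (Y, k)))
  | bx {X Y : Kd} (h : StripB X Y) {i j k o : ℕ} (hij : j < i) :
      Alw s(s((b, o), (X, j)), s((X, i), (Y, k)))
  | ab {o o' k l : ℕ} : Alw s(s((a, o), (b, o')), s((C, k), (D, l)))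

structure Valid (t : Lab → ℝ) : Prop where
  lo : ∀ (k : Kd) (i : ℕ), (i : ℝ) / (i + 1) < t (k, i)
  hi : ∀ (k : Kd) (i : ℕ), t (k, i) < ((i : ℝ) + 1) / (i + 2)

theorem Valid.pos {t : Lab → ℝ} (h : Valid t) (l : Lab) : 0 < t l :=
  lt_of_le_of_lt (by positivity) (h.lo l.1 l.2)

theorem Valid.lt_one {t : Lab → ℝ} (h : Valid t) (l : Lab) : t l < 1 :=
  lt_of_lt_of_le (h.hi l.1 l.2) (by rw [div_le_one (by positivity)]; linarith)

theorem Valid.lt {t : Lab → ℝ} (h : Valid t) (k : Kd) {i j : ℕ} (hij : i < j) :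
    t (k, i) < t (k, j) := by
  refine (h.hi k i).trans (lt_of_le_of_lt ?_ (h.lo k j))
  rw [div_le_div_iff₀ (by positivity) (by positivity)]
  have : (i : ℝ) + 1 ≤ j := by exact_mod_cast hij
  nlinarith

def pt (t : Lab → ℝ) (l : Lab) : ℝ × ℝ := P l.1 (t l)

/-- Outcome of the comparison of two edges. -/
def Out (t : Lab → ℝ) (l₁ l₂ l₃ l₄ : Lab) : Prop :=
  NC (pt t l₁) (pt t l₂) (pt t l₃) (pt t l₄) ∨
    (Alw s(s(l₁, l₂), s(l₃, l₄)) ∧ Uniq (pt t l₁) (pt t l₂) (pt t l₃) (pt t l₄))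

theorem Out.symm {t : Lab → ℝ} {l₁ l₂ l₃ l₄ : Lab} (h : Out t l₁ l₂ l₃ l₄) :
    Out t l₃ l₄ l₁ l₂ := by
  rcases h with h | ⟨h, h'⟩
  · exact Or.inl h.symm
  · exact Or.inr ⟨by rw [Sym2.eq_swap]; exact h, h'.symm⟩

theorem Out.flip {t : Lab → ℝ} {l₁ l₂ l₃ l₄ : Lab} (h : Out t l₁ l₂ l₃ l₄) :
    Out t l₂ l₁ l₃ l₄ := by
  rcases h with h | ⟨h, h'⟩
  · exact Or.inl h.flip
  · exact Or.inr ⟨by rw [Sym2.eq_swap (a := l₂)]; exact h, h'.flip⟩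

theorem Out.flip' {t : Lab → ℝ} {l₁ l₂ l₃ l₄ : Lab} (h : Out t l₁ l₂ l₃ l₄) :
    Out t l₁ l₂ l₄ l₃ := h.symm.flip.symm

/-! ### Comparing edges -/

theorem strip_nc {X Y : Kd} (h : Strip X Y) {s₁ s₂ s₃ s₄ : ℝ} (p₁ : 0 < s₁) (p₂ : 0 < s₂)
    (p₃ : 0 < s₃) (p₄ : 0 < s₄) (q₁ : s₁ < 1) (q₂ : s₂ < 1) (q₃ : s₃ < 1) (q₄ : s₄ < 1)
    (h₁ : s₁ ≤ s₃) (h₂ : s₂ ≤ s₄) (hne : s₁ < s₃ ∨ s₂ < s₄) :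
    NC (P X s₃) (P Y s₄) (P X s₁) (P Y s₂) := by
  have a₁ := mul_nonneg (sub_nonneg.2 h₁) p₄.le
  have a₂ := mul_nonneg (sub_nonneg.2 h₁) (sub_nonneg.2 q₄.le)
  have a₃ := mul_nonneg (sub_nonneg.2 h₂) p₃.le
  have a₄ := mul_nonneg (sub_nonneg.2 h₂) (sub_nonneg.2 q₃.le)
  have pos : 0 < (s₃ - s₁) + (s₄ - s₂) := by rcases hne with h | h <;> linarith
  have b : (s₃ - s₁) * (1 - s₄) + (s₄ - s₂) * (1 - s₃) > 0 := by
    rcases hne with h | h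
    · have := mul_pos (sub_pos.2 h) (sub_pos.2 q₄); linarith
    · have := mul_pos (sub_pos.2 h) (sub_pos.2 q₃); linarith
  cases h
  · refine nc_pos ?_ ?_ ?_ <;> simp only [orient, P] <;> nlinarith
  · refine nc_pos ?_ ?_ ?_ <;> simp only [orient, P] <;> nlinarith
  · refine nc_pos ?_ ?_ ?_ <;> simp only [orient, P] <;> nlinarith
  · refine nc_pos ?_ ?_ ?_ <;> simp only [orient, P] <;> nlinarith

theorem strip_or {X Y : Kd} (h : StripA X Y ∨ StripB X Y) {s₁ s₂ s₃ : ℝ} (p₁ : 0 < s₁)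
    (p₂ : 0 < s₂) (p₃ : 0 < s₃) (q₁ : s₁ < 1) (q₂ : s₂ < 1) (q₃ : s₃ < 1)
    (h₁ : s₁ ≠ s₃) : orient (P X s₁) (P Y s₂) (P X s₃) ≠ 0 := by
  have key : ∃ c : ℝ, c ≠ 0 ∧ orient (P X s₁) (P Y s₂) (P X s₃) = (s₃ - s₁) * c := by
    rcases h with h | h <;> cases h
    · exact ⟨-(4 + 2 * s₂), by intro h; linarith, by simp only [orient, P]; ring⟩
    · exact ⟨(4 + 2 * s₂), by intro h; linarith, by simp only [orient, P]; ring⟩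
    · exact ⟨-6 * (1 - s₂), by intro h; linarith, by simp only [orient, P]; ring⟩
    · exact ⟨6 * (1 - s₂), by intro h; linarith, by simp only [orient, P]; ring⟩
    · exact ⟨-(1 + 2 * s₂), by intro h; linarith, by simp only [orient, P]; ring⟩
    · exact ⟨(1 + 2 * s₂), by intro h; linarith, by simp only [orient, P]; ring⟩
    · exact ⟨-(1 + 2 * s₂), by intro h; linarith, by simp only [orient, P]; ring⟩
    · exact ⟨(1 + 2 * s₂), by intro h; linarith, by simp only [orient, P]; ring⟩
  obtain ⟨c, hc, e⟩ := key
  rw [e]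
  exact mul_ne_zero (sub_ne_zero.2 h₁.symm) hc

theorem ax_nc {X Y : Kd} (h : StripA X Y) {s₁ s₂ s₃ o : ℝ} (p₁ : 0 < s₁) (p₂ : 0 < s₂)
    (p₃ : 0 < s₃) (q₁ : s₁ < 1) (q₂ : s₂ < 1) (q₃ : s₃ < 1) (h₁ : s₃ ≤ s₁) :
    NC (P X s₁) (P Y s₂) (P a o) (P X s₃) := by
  have a₁ := mul_nonneg (sub_nonneg.2 h₁) p₂.le
  have a₂ := mul_nonneg (sub_nonneg.2 h₁) (sub_nonneg.2 q₂.le)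
  have a₃ := mul_pos p₁ p₂
  have a₄ := mul_pos p₁ (sub_pos.2 q₂)
  have a₅ := mul_pos p₂ (sub_pos.2 q₁)
  have a₆ := mul_pos (sub_pos.2 q₁) (sub_pos.2 q₂)
  cases h
  · refine nc_pos ?_ ?_ ?_ <;> simp only [orient, P] <;> nlinarith
  · refine nc_neg ?_ ?_ ?_ <;> simp only [orient, P] <;> nlinarith
  · refine nc_pos ?_ ?_ ?_ <;> simp only [orient, P] <;> nlinarith
  · refine nc_neg ?_ ?_ ?_ <;> simp only [orient, P] <;> nlinarith

theorem bx_nc {X Y : Kd} (h : StripB X Y) {s₁ s₂ s₃ o : ℝ} (p₁ : 0 < s₁) (p₂ : 0 < s₂)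
    (p₃ : 0 < s₃) (q₁ : s₁ < 1) (q₂ : s₂ < 1) (q₃ : s₃ < 1) (h₁ : s₁ ≤ s₃) :
    NC (P b o) (P X s₃) (P X s₁) (P Y s₂) := by
  have a₁ := mul_nonneg (sub_nonneg.2 h₁) p₂.le
  have a₂ := mul_nonneg (sub_nonneg.2 h₁) (sub_nonneg.2 q₂.le)
  have a₃ := mul_pos p₃ p₂
  have a₄ := mul_pos p₃ (sub_pos.2 q₂)
  have a₅ := mul_pos p₂ (sub_pos.2 q₃)
  have a₆ := mul_pos (sub_pos.2 q₃) (sub_pos.2 q₂)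
  cases h
  · refine nc_neg ?_ ?_ ?_ <;> simp only [orient, P] <;> nlinarith
  · refine nc_pos ?_ ?_ ?_ <;> simp only [orient, P] <;> nlinarith
  · refine nc_neg ?_ ?_ ?_ <;> simp only [orient, P] <;> nlinarith
  · refine nc_pos ?_ ?_ ?_ <;> simp only [orient, P] <;> nlinarith

def IsHub : Kd → Prop
  | a => True
  | b => True
  | _ => False

theorem hub_or {H X : Kd} (hH : IsHub H) (hX : ¬ IsHub X) {s s' o : ℝ} (h : s ≠ s') :
    orient (P H o) (P X s) (P X s') ≠ 0 := by
  have key : ∃ c : ℝ, c ≠ 0 ∧ orient (P H o) (P X s) (P X s') = (s - s') * c := by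
    cases H <;> simp only [IsHub] at hH <;> cases X <;> simp only [IsHub, not_true_eq_false] at hX
    · exact ⟨-1, by norm_num, by simp only [orient, P]; ring⟩
    · exact ⟨1, by norm_num, by simp only [orient, P]; ring⟩
    · exact ⟨-4, by norm_num, by simp only [orient, P]; ring⟩
    · exact ⟨4, by norm_num, by simp only [orient, P]; ring⟩
    · exact ⟨4, by norm_num, by simp only [orient, P]; ring⟩
    · exact ⟨-4, by norm_num, by simp only [orient, P]; ring⟩
    · exact ⟨1, by norm_num, by simp only [orient, P]; ring⟩
    · exact ⟨-1, by norm_num, by simp only [orient, P]; ring⟩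
  obtain ⟨c, hc, e⟩ := key
  rw [e]
  exact mul_ne_zero (sub_ne_zero.2 h) hc

theorem Valid.inj {t : Lab → ℝ} (hv : Valid t) (k : Kd) {i j : ℕ} (h : i ≠ j) :
    t (k, i) ≠ t (k, j) := by
  rcases lt_or_gt_of_ne h with h | h
  · exact (hv.lt k h).ne
  · exact (hv.lt k h).ne'

theorem Valid.le {t : Lab → ℝ} (hv : Valid t) (k : Kd) {i j : ℕ} (h : i ≤ j) :
    t (k, i) ≤ t (k, j) := by
  rcases h.lt_or_eq with h | h
  · exact (hv.lt k h).le
  · rw [h]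

theorem Strip.or {X Y : Kd} (h : Strip X Y) : StripA X Y ∨ StripB X Y := by
  cases h
  · exact Or.inl .AB
  · exact Or.inr .BC
  · exact Or.inl .CD
  · exact Or.inr .DA

theorem out_strip {t : Lab → ℝ} (hv : Valid t) {X Y : Kd} (h : Strip X Y) (i j k l : ℕ)
    (hne : ¬ (i = k ∧ j = l)) : Out t (X, i) (Y, j) (X, k) (Y, l) := by
  have main : ∀ i j k l : ℕ, i ≤ k → j ≤ l → ¬ (i = k ∧ j = l) →
      NC (pt t (X, k)) (pt t (Y, l)) (pt t (X, i)) (pt t (Y, j)) := by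
    intro i j k l hik hjl hne
    refine strip_nc h (hv.pos _) (hv.pos _) (hv.pos _) (hv.pos _) (hv.lt_one _) (hv.lt_one _)
      (hv.lt_one _) (hv.lt_one _) (hv.le _ hik) (hv.le _ hjl) ?_
    by_cases hh : i = k
    · right; exact hv.lt _ (by omega)
    · left; exact hv.lt _ (by omega)
  have un : i ≠ k → Uniq (pt t (X, i)) (pt t (Y, j)) (pt t (X, k)) (pt t (Y, l)) := by
    intro hik
    exact uniq_of_orient (strip_or h.or (hv.pos _) (hv.pos _) (hv.pos _) (hv.lt_one _)
      (hv.lt_one _) (hv.lt_one _) (hv.inj _ hik))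
  by_cases h1 : i ≤ k ∧ j ≤ l
  · exact Or.inl (main _ _ _ _ h1.1 h1.2 hne).symm
  by_cases h2 : k ≤ i ∧ l ≤ j
  · exact Or.inl (main _ _ _ _ h2.1 h2.2 (by omega))
  right
  refine ⟨?_, un (by omega)⟩
  by_cases h3 : k < i
  · exact Alw.xxyy h h3 (by omega)
  · rw [Sym2.eq_swap]
    exact Alw.xxyy h (by omega) (by omega)

theorem out_ax {t : Lab → ℝ} (hv : Valid t) {X Y : Kd} (h : StripA X Y) (o i j k : ℕ) :
    Out t (a, o) (X, i) (X, j) (Y, k) := by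
  by_cases h1 : i ≤ j
  · exact Or.inl (ax_nc h (hv.pos _) (hv.pos _) (hv.pos _) (hv.lt_one _) (hv.lt_one _)
      (hv.lt_one _) (hv.le _ h1)).symm
  · refine Or.inr ⟨Alw.ax h (by omega), ?_⟩
    refine (uniq_of_orient ?_).symm.flip
    exact strip_or (Or.inl h) (hv.pos _) (hv.pos _) (hv.pos _) (hv.lt_one _) (hv.lt_one _)
      (hv.lt_one _) (hv.inj _ (by omega))

theorem out_bx {t : Lab → ℝ} (hv : Valid t) {X Y : Kd} (h : StripB X Y) (o i j k : ℕ) :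
    Out t (b, o) (X, i) (X, j) (Y, k) := by
  by_cases h1 : j ≤ i
  · exact Or.inl (bx_nc h (hv.pos _) (hv.pos _) (hv.pos _) (hv.lt_one _) (hv.lt_one _)
      (hv.lt_one _) (hv.le _ h1))
  · refine Or.inr ⟨Alw.bx h (by omega), ?_⟩
    refine (uniq_of_orient ?_).symm.flip
    exact strip_or (Or.inr h) (hv.pos _) (hv.pos _) (hv.pos _) (hv.lt_one _) (hv.lt_one _)
      (hv.lt_one _) (hv.inj _ (by omega))

theorem out_ab {t : Lab → ℝ} (hv : Valid t) (o o' k l : ℕ) :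
    Out t (a, o) (b, o') (C, k) (D, l) := by
  refine Or.inr ⟨Alw.ab, uniq_of_orient ?_⟩
  have := hv.lt_one (C, k)
  apply ne_of_lt
  simp only [pt, orient, P]
  linarith

theorem out_hub {t : Lab → ℝ} (hv : Valid t) {H X : Kd} (hH : IsHub H) (hX : ¬ IsHub X)
    (i j : ℕ) (hij : i ≠ j) (o o' : ℕ) : Out t (H, o) (X, i) (H, o') (X, j) := by
  left
  have e : pt t (H, o') = pt t (H, o) := by
    cases H <;> first | rfl | simp only [IsHub] at hH
  have h0 : orient (pt t (H, o)) (pt t (X, i)) (pt t (H, o)) = 0 := by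
    simp only [orient]; ring
  have h1 : orient (pt t (H, o)) (pt t (X, i)) (pt t (X, j)) ≠ 0 := hub_or hH hX (hv.inj _ hij)
  rw [e]
  rcases lt_or_gt_of_ne h1 with h | h
  · exact nc_neg h0.le h.le (by linarith)
  · exact nc_pos h0.ge h.le (by linarith)

theorem out_lin {t : Lab → ℝ} (α β γ : ℝ) {u v w x : Lab} (hu : 0 ≤ lin α β γ (pt t u))
    (hv : 0 ≤ lin α β γ (pt t v)) (huv : 0 < lin α β γ (pt t u) + lin α β γ (pt t v))
    (hw : lin α β γ (pt t w) ≤ 0) (hx : lin α β γ (pt t x) ≤ 0) : Out t u v w x :=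
  Or.inl (nc_of_lin α β γ hu hv huv hw hx)

/-- the hubs have only index `0` -/
def Ok (l : Lab) : Prop := IsHub l.1 → l.2 = 0

set_option maxHeartbeats 4000000 in
theorem out_ori {t : Lab → ℝ} (hv : Valid t) {k₁ k₂ k₃ k₄ : Kd} (h : Ori k₁ k₂)
    (h' : Ori k₃ k₄) (i j k l : ℕ) (o₁ : Ok (k₁, i)) (o₂ : Ok (k₂, j)) (o₃ : Ok (k₃, k))
    (o₄ : Ok (k₄, l))
    (hne : ¬ (k₁ = k₃ ∧ k₂ = k₄ ∧ i = k ∧ j = l)) : Out t (k₁, i) (k₂, j) (k₃, k) (k₄, l) := by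
  have p₁ := hv.pos (k₁, i)
  have p₂ := hv.pos (k₂, j)
  have p₃ := hv.pos (k₃, k)
  have p₄ := hv.pos (k₄, l)
  have q₁ := hv.lt_one (k₁, i)
  have q₂ := hv.lt_one (k₂, j)
  have q₃ := hv.lt_one (k₃, k)
  have q₄ := hv.lt_one (k₄, l)
  have lines : ∀ α β γ : ℝ, (0 ≤ lin α β γ (pt t (k₁, i)) ∧ 0 ≤ lin α β γ (pt t (k₂, j)) ∧
      0 < lin α β γ (pt t (k₁, i)) + lin α β γ (pt t (k₂, j)) ∧
      lin α β γ (pt t (k₃, k)) ≤ 0 ∧ lin α β γ (pt t (k₄, l)) ≤ 0) →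
      Out t (k₁, i) (k₂, j) (k₃, k) (k₄, l) :=
    fun α β γ ⟨h1, h2, h3, h4, h5⟩ => out_lin α β γ h1 h2 h3 h4 h5
  have lines' : ∀ α β γ : ℝ, (0 ≤ lin α β γ (pt t (k₃, k)) ∧ 0 ≤ lin α β γ (pt t (k₄, l)) ∧
      0 < lin α β γ (pt t (k₃, k)) + lin α β γ (pt t (k₄, l)) ∧
      lin α β γ (pt t (k₁, i)) ≤ 0 ∧ lin α β γ (pt t (k₂, j)) ≤ 0) →
      Out t (k₁, i) (k₂, j) (k₃, k) (k₄, l) :=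
    fun α β γ ⟨h1, h2, h3, h4, h5⟩ => (out_lin α β γ h1 h2 h3 h4 h5).symm
  cases h <;> cases h' <;>
  first
  | (refine out_strip hv ?_ _ _ _ _ ?_; · constructor
     · simpa using hne)
  | (refine out_ax hv ?_ _ _ _ _; constructor)
  | (refine (out_ax hv ?_ _ _ _ _).symm; constructor)
  | (refine (out_ax hv ?_ _ _ _ _).flip'; constructor)
  | (refine (out_ax hv ?_ _ _ _ _).flip'.symm; constructor)
  | (refine out_bx hv ?_ _ _ _ _; constructor)
  | (refine (out_bx hv ?_ _ _ _ _).symm; constructor)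
  | (refine (out_bx hv ?_ _ _ _ _).flip'; constructor)
  | (refine (out_bx hv ?_ _ _ _ _).flip'.symm; constructor)
  | exact out_ab hv _ _ _ _
  | exact (out_ab hv _ _ _ _).symm
  | (refine out_hub hv ?_ ?_ _ _ ?_ _ _
     · exact True.intro
     · exact fun h => h
     intro h
     exact hne ⟨rfl, rfl, (o₁ True.intro).trans (o₃ True.intro).symm, h⟩)
  | exact absurd ⟨rfl, rfl, (o₁ True.intro).trans (o₃ True.intro).symm,
      (o₂ True.intro).trans (o₄ True.intro).symm⟩ hne
  | (clear hv hne o₁ o₂ o₃ o₄; simp only [lin, pt, P] at lines lines'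
     first
     | (refine lines 1 0 0 ⟨?_, ?_, ?_, ?_, ?_⟩ <;> linarith)
     | (refine lines' 1 0 0 ⟨?_, ?_, ?_, ?_, ?_⟩ <;> linarith)
     | (refine lines (-1) 0 0 ⟨?_, ?_, ?_, ?_, ?_⟩ <;> linarith)
     | (refine lines' (-1) 0 0 ⟨?_, ?_, ?_, ?_, ?_⟩ <;> linarith)
     | (refine lines (-1) 1 0 ⟨?_, ?_, ?_, ?_, ?_⟩ <;> linarith)
     | (refine lines' (-1) 1 0 ⟨?_, ?_, ?_, ?_, ?_⟩ <;> linarith)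
     | (refine lines 1 1 0 ⟨?_, ?_, ?_, ?_, ?_⟩ <;> linarith)
     | (refine lines' 1 1 0 ⟨?_, ?_, ?_, ?_, ?_⟩ <;> linarith)
     | (refine lines (-3) 1 (-3) ⟨?_, ?_, ?_, ?_, ?_⟩ <;> linarith)
     | (refine lines' (-3) 1 (-3) ⟨?_, ?_, ?_, ?_, ?_⟩ <;> linarith)
     | (refine lines 3 1 (-3) ⟨?_, ?_, ?_, ?_, ?_⟩ <;> linarith)
     | (refine lines' 3 1 (-3) ⟨?_, ?_, ?_, ?_, ?_⟩ <;> linarith)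
     | (refine lines 0 1 (3/2) ⟨?_, ?_, ?_, ?_, ?_⟩ <;> linarith)
     | (refine lines' 0 1 (3/2) ⟨?_, ?_, ?_, ?_, ?_⟩ <;> linarith)
     | (refine lines 0 1 1 ⟨?_, ?_, ?_, ?_, ?_⟩ <;> linarith)
     | (refine lines' 0 1 1 ⟨?_, ?_, ?_, ?_, ?_⟩ <;> linarith)
     | (refine lines (-7/2) 1 (-4) ⟨?_, ?_, ?_, ?_, ?_⟩ <;> linarith)
     | (refine lines' (-7/2) 1 (-4) ⟨?_, ?_, ?_, ?_, ?_⟩ <;> linarith)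
     | (refine lines (7/2) 1 (-4) ⟨?_, ?_, ?_, ?_, ?_⟩ <;> linarith)
     | (refine lines' (7/2) 1 (-4) ⟨?_, ?_, ?_, ?_, ?_⟩ <;> linarith))

theorem Ok.eq {H : Kd} {i j : ℕ} (h : Ok (H, i)) (h' : Ok (H, j)) (hH : IsHub H) : i = j :=
  (h hH).trans (h' hH).symm

theorem avoid_strip {t : Lab → ℝ} (hv : Valid t) {X Y : Kd} (h : StripA X Y ∨ StripB X Y)
    (i j k : ℕ) (hne : k ≠ i) : ¬ InSeg (pt t (X, k)) (pt t (X, i)) (pt t (Y, j)) :=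
  not_inSeg_of_orient (strip_or h (hv.pos _) (hv.pos _) (hv.pos _) (hv.lt_one _) (hv.lt_one _)
    (hv.lt_one _) (hv.inj _ hne.symm))

theorem avoid_hub {t : Lab → ℝ} (hv : Valid t) {H X : Kd} (hH : IsHub H) (hX : ¬ IsHub X)
    (o i k : ℕ) (hne : k ≠ i) : ¬ InSeg (pt t (X, k)) (pt t (H, o)) (pt t (X, i)) :=
  not_inSeg_of_orient (hub_or hH hX (hv.inj _ hne.symm))

set_option maxHeartbeats 4000000 in
theorem avoid_ori {t : Lab → ℝ} (hv : Valid t) {k₁ k₂ : Kd} (h : Ori k₁ k₂) (c : Kd)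
    (i j k : ℕ) (o₁ : Ok (k₁, i)) (o₂ : Ok (k₂, j)) (o₃ : Ok (c, k))
    (hne : ¬ (c = k₁ ∧ k = i)) (hne' : ¬ (c = k₂ ∧ k = j)) :
    ¬ InSeg (pt t (c, k)) (pt t (k₁, i)) (pt t (k₂, j)) := by
  have p₁ := hv.pos (k₁, i)
  have p₂ := hv.pos (k₂, j)
  have p₃ := hv.pos (c, k)
  have q₁ := hv.lt_one (k₁, i)
  have q₂ := hv.lt_one (k₂, j)
  have q₃ := hv.lt_one (c, k)
  have lines : ∀ α β γ : ℝ, (0 < lin α β γ (pt t (c, k)) ∧ lin α β γ (pt t (k₁, i)) ≤ 0 ∧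
      lin α β γ (pt t (k₂, j)) ≤ 0) → ¬ InSeg (pt t (c, k)) (pt t (k₁, i)) (pt t (k₂, j)) :=
    fun α β γ ⟨h1, h2, h3⟩ => not_inSeg_of_lin α β γ h1 h2 h3
  cases h <;> cases c <;>
  first
  | (refine avoid_strip hv ?_ _ _ _ ?_
     · first
       | (left; constructor)
       | (right; constructor)
     · exact fun h => hne ⟨rfl, h⟩)
  | (refine fun h => avoid_strip hv ?_ _ _ _ ?_ h.swap
     · first
       | (left; constructor)
       | (right; constructor)
     · exact fun h => hne' ⟨rfl, h⟩)
  | (refine avoid_hub hv ?_ ?_ _ _ _ ?_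
     · exact True.intro
     · exact fun h => h
     · exact fun h => hne' ⟨rfl, h⟩)
  | (refine absurd ⟨rfl, o₃.eq o₁ ?_⟩ hne; exact True.intro)
  | (refine absurd ⟨rfl, o₃.eq o₂ ?_⟩ hne'; exact True.intro)
  | (clear hv hne hne' o₁ o₂ o₃; simp only [lin, pt, P] at lines
     first
     | (refine lines 1 0 0 ⟨?_, ?_, ?_⟩ <;> linarith)
     | (refine lines (-1) 0 0 ⟨?_, ?_, ?_⟩ <;> linarith)
     | (refine lines 0 1 1 ⟨?_, ?_, ?_⟩ <;> linarith)
     | (refine lines 0 (-1) (-1) ⟨?_, ?_, ?_⟩ <;> linarith)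
     | (refine lines 0 1 0 ⟨?_, ?_, ?_⟩ <;> linarith)
     | (refine lines 0 (-1) 0 ⟨?_, ?_, ?_⟩ <;> linarith)
     | (refine lines 0 1 (3/2) ⟨?_, ?_, ?_⟩ <;> linarith)
     | (refine lines 0 1 (-3) ⟨?_, ?_, ?_⟩ <;> linarith)
     | (refine lines 3 (-1) 3 ⟨?_, ?_, ?_⟩ <;> linarith)
     | (refine lines (-3) (-1) 3 ⟨?_, ?_, ?_⟩ <;> linarith)
     | (refine lines (7/2) (-1) 4 ⟨?_, ?_, ?_⟩ <;> linarith)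
     | (refine lines (-7/2) (-1) 4 ⟨?_, ?_, ?_⟩ <;> linarith))

/-- the movable vertices: two positions and a neighbour -/
theorem move_ori {k₁ k₂ : Kd} (h : AdjK k₁ k₂) (hX : ¬ IsHub k₁) {s s' r : ℝ}
    (hs : s ≠ s') (r0 : 0 < r) (r1 : r < 1) {p : ℝ × ℝ} (h1 : InSeg p (P k₁ s) (P k₂ r))
    (h2 : InSeg p (P k₁ s') (P k₂ r)) : p = P k₂ r := by
  have key : ∃ α β γ : ℝ, lin α β γ (P k₁ s) = 0 ∧ lin α β γ (P k₁ s') = 0 ∧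
      lin α β γ (P k₂ r) ≠ 0 ∧ P k₁ s ≠ P k₁ s' := by
    cases k₁
    · exact absurd True.intro hX
    · exact absurd True.intro hX
    · refine ⟨-1, 1, 0, by simp only [lin, P]; ring, by simp only [lin, P]; ring, ?_, ?_⟩
      · rcases h with h | h <;> cases h <;> simp only [lin, P] <;> intro h <;> linarith
      · intro h; simp only [P, Prod.mk.injEq] at h; apply hs; linarith [h.1]
    · refine ⟨1, 1, 0, by simp only [lin, P]; ring, by simp only [lin, P]; ring, ?_, ?_⟩
      · rcases h with h | h <;> cases h <;> simp only [lin, P] <;> intro h <;> linarith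
      · intro h; simp only [P, Prod.mk.injEq] at h; apply hs; linarith [h.1]
    · refine ⟨3, 1, -3, by simp only [lin, P]; ring, by simp only [lin, P]; ring, ?_, ?_⟩
      · rcases h with h | h <;> cases h <;> simp only [lin, P] <;> intro h <;> linarith
      · intro h; simp only [P, Prod.mk.injEq] at h; apply hs; linarith [h.1]
    · refine ⟨-3, 1, -3, by simp only [lin, P]; ring, by simp only [lin, P]; ring, ?_, ?_⟩
      · rcases h with h | h <;> cases h <;> simp only [lin, P] <;> intro h <;> linarith
      · intro h; simp only [P, Prod.mk.injEq] at h; apply hs; linarith [h.1]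
  obtain ⟨α, β, γ, e1, e2, e3, e4⟩ := key
  exact eq_of_two α β γ e1 e2 e3 e4 h1 h2

theorem pt_inj {t : Lab → ℝ} (hv : Valid t) {l l' : Lab} (o : Ok l) (o' : Ok l')
    (h : pt t l = pt t l') : l = l' := by
  obtain ⟨k, i⟩ := l
  obtain ⟨k', i'⟩ := l'
  have p₁ := hv.pos (k, i)
  have p₂ := hv.pos (k', i')
  have q₁ := hv.lt_one (k, i)
  have q₂ := hv.lt_one (k', i')
  have hk : k = k' := by
    cases k <;> cases k' <;> first
    | rfl
    | (exfalso; simp only [pt, P, Prod.mk.injEq] at h; linarith [h.1, h.2])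
  subst hk
  by_contra hne
  have hi : i ≠ i' := fun h => hne (by rw [h])
  by_cases hH : IsHub k
  · exact hi (o.eq o' hH)
  · have := hv.inj k hi
    cases k <;> first
    | exact hH True.intro
    | (apply this; simp only [pt, P, Prod.mk.injEq] at h; linarith [h.1])

theorem out_adj {t : Lab → ℝ} (hv : Valid t) {l₁ l₂ l₃ l₄ : Lab} (h : AdjK l₁.1 l₂.1)
    (h' : AdjK l₃.1 l₄.1) (o₁ : Ok l₁) (o₂ : Ok l₂) (o₃ : Ok l₃) (o₄ : Ok l₄)
    (hne : s(l₁, l₂) ≠ s(l₃, l₄)) : Out t l₁ l₂ l₃ l₄ := by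
  have base : ∀ l₁ l₂ l₃ l₄ : Lab, Ori l₁.1 l₂.1 → Ori l₃.1 l₄.1 → Ok l₁ → Ok l₂ → Ok l₃ →
      Ok l₄ → s(l₁, l₂) ≠ s(l₃, l₄) → Out t l₁ l₂ l₃ l₄ := by
    rintro ⟨k₁, i⟩ ⟨k₂, j⟩ ⟨k₃, k⟩ ⟨k₄, l⟩ h h' o₁ o₂ o₃ o₄ hne
    refine out_ori hv h h' i j k l o₁ o₂ o₃ o₄ ?_
    rintro ⟨rfl, rfl, rfl, rfl⟩
    exact hne rfl
  rcases h with h | h <;> rcases h' with h' | h'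
  · exact base _ _ _ _ h h' o₁ o₂ o₃ o₄ hne
  · refine (base _ _ _ _ h h' o₁ o₂ o₄ o₃ ?_).flip'
    rwa [Sym2.eq_swap (a := l₄)]
  · refine (base _ _ _ _ h h' o₂ o₁ o₃ o₄ ?_).flip
    rwa [Sym2.eq_swap (a := l₂)]
  · refine (base _ _ _ _ h h' o₂ o₁ o₄ o₃ ?_).flip'.flip
    rwa [Sym2.eq_swap (a := l₂), Sym2.eq_swap (a := l₄)]

theorem avoid_adj {t : Lab → ℝ} (hv : Valid t) {l₁ l₂ c : Lab} (h : AdjK l₁.1 l₂.1)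
    (o₁ : Ok l₁) (o₂ : Ok l₂) (o₃ : Ok c) (h₁ : c ≠ l₁) (h₂ : c ≠ l₂) :
    ¬ InSeg (pt t c) (pt t l₁) (pt t l₂) := by
  obtain ⟨k₁, i⟩ := l₁
  obtain ⟨k₂, j⟩ := l₂
  obtain ⟨k, l⟩ := c
  rcases h with h | h
  · refine avoid_ori hv h _ _ _ _ o₁ o₂ o₃ ?_ ?_
    · rintro ⟨rfl, rfl⟩; exact h₁ rfl
    · rintro ⟨rfl, rfl⟩; exact h₂ rfl
  · refine fun hh => avoid_ori hv h _ _ _ _ o₂ o₁ o₃ ?_ ?_ hh.swap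
    · rintro ⟨rfl, rfl⟩; exact h₂ rfl
    · rintro ⟨rfl, rfl⟩; exact h₁ rfl

/-! ### Crossings on the level of labels -/

structure CrL (t : Lab → ℝ) (l₁ l₂ l₃ l₄ : Lab) (p : ℝ × ℝ) : Prop where
  adj : AdjK l₁.1 l₂.1
  adj' : AdjK l₃.1 l₄.1
  o₁ : Ok l₁
  o₂ : Ok l₂
  o₃ : Ok l₃
  o₄ : Ok l₄
  ne : s(l₁, l₂) ≠ s(l₃, l₄)
  seg : InSeg p (pt t l₁) (pt t l₂)
  seg' : InSeg p (pt t l₃) (pt t l₄)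
  n₁ : p ≠ pt t l₁
  n₂ : p ≠ pt t l₂
  n₃ : p ≠ pt t l₃
  n₄ : p ≠ pt t l₄

theorem AdjK.swap {k l : Kd} (h : AdjK k l) : AdjK l k := Or.symm h

theorem AdjK.ne {k l : Kd} (h : AdjK k l) : k ≠ l := by
  rintro rfl
  rcases h with h | h <;> cases h

theorem CrL.symm {t : Lab → ℝ} {l₁ l₂ l₃ l₄ : Lab} {p : ℝ × ℝ} (h : CrL t l₁ l₂ l₃ l₄ p) :
    CrL t l₃ l₄ l₁ l₂ p :=
  ⟨h.adj', h.adj, h.o₃, h.o₄, h.o₁, h.o₂, h.ne.symm, h.seg', h.seg, h.n₃, h.n₄, h.n₁, h.n₂⟩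

theorem CrL.flip {t : Lab → ℝ} {l₁ l₂ l₃ l₄ : Lab} {p : ℝ × ℝ} (h : CrL t l₁ l₂ l₃ l₄ p) :
    CrL t l₂ l₁ l₃ l₄ p :=
  ⟨h.adj.swap, h.adj', h.o₂, h.o₁, h.o₃, h.o₄, by rw [Sym2.eq_swap]; exact h.ne, h.seg.swap, h.seg',
    h.n₂, h.n₁, h.n₃, h.n₄⟩

theorem CrL.out {t : Lab → ℝ} (hv : Valid t) {l₁ l₂ l₃ l₄ : Lab} {p : ℝ × ℝ}
    (h : CrL t l₁ l₂ l₃ l₄ p) :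
    Alw s(s(l₁, l₂), s(l₃, l₄)) ∧ Uniq (pt t l₁) (pt t l₂) (pt t l₃) (pt t l₄) := by
  rcases out_adj hv h.adj h.adj' h.o₁ h.o₂ h.o₃ h.o₄ h.ne with g | g
  · rcases g p h.seg h.seg' with e | e | e | e
    · exact absurd e h.n₁
    · exact absurd e h.n₂
    · exact absurd e h.n₃
    · exact absurd e h.n₄
  · exact g

theorem CrL.uniq {t : Lab → ℝ} (hv : Valid t) {l₁ l₂ l₃ l₄ : Lab} {p q : ℝ × ℝ}
    (h : CrL t l₁ l₂ l₃ l₄ p) (h' : CrL t l₁ l₂ l₃ l₄ q) : p = q :=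
  (h.out hv).2 p q h.seg h.seg' h'.seg h'.seg'

theorem Alw.disj {q : Sym2 (Sym2 Lab)} (h : Alw q) :
    ∀ l₁ l₂ l₃ l₄ : Lab, q = s(s(l₁, l₂), s(l₃, l₄)) →
      l₁ ≠ l₃ ∧ l₁ ≠ l₄ ∧ l₂ ≠ l₃ ∧ l₂ ≠ l₄ := by
  have key : ∀ m₁ m₂ m₃ m₄ : Lab, (m₁ ≠ m₃ ∧ m₁ ≠ m₄ ∧ m₂ ≠ m₃ ∧ m₂ ≠ m₄) →
      ∀ l₁ l₂ l₃ l₄ : Lab, s(s(m₁, m₂), s(m₃, m₄)) = s(s(l₁, l₂), s(l₃, l₄)) →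
      l₁ ≠ l₃ ∧ l₁ ≠ l₄ ∧ l₂ ≠ l₃ ∧ l₂ ≠ l₄ := by
    rintro m₁ m₂ m₃ m₄ ⟨h1, h2, h3, h4⟩ l₁ l₂ l₃ l₄ h
    rw [Sym2.eq_iff] at h
    simp only [Sym2.eq_iff] at h
    rcases h with ⟨⟨rfl, rfl⟩ | ⟨rfl, rfl⟩, ⟨rfl, rfl⟩ | ⟨rfl, rfl⟩⟩ |
      ⟨⟨rfl, rfl⟩ | ⟨rfl, rfl⟩, ⟨rfl, rfl⟩ | ⟨rfl, rfl⟩⟩ <;>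
    exact ⟨by first | assumption | (apply Ne.symm; assumption),
      by first | assumption | (apply Ne.symm; assumption),
      by first | assumption | (apply Ne.symm; assumption),
      by first | assumption | (apply Ne.symm; assumption)⟩
  cases h with
  | xxyy h hi hk =>
    apply key
    cases h <;> simp <;> omega
  | ax h hi =>
    apply key
    cases h <;> simp <;> omega
  | bx h hi =>
    apply key
    cases h <;> simp <;> omega
  | ab => apply key; simp

theorem CrL.disj {t : Lab → ℝ} (hv : Valid t) {l₁ l₂ l₃ l₄ : Lab} {p : ℝ × ℝ}
    (h : CrL t l₁ l₂ l₃ l₄ p) : l₁ ≠ l₃ ∧ l₁ ≠ l₄ ∧ l₂ ≠ l₃ ∧ l₂ ≠ l₄ :=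
  (h.out hv).1.disj _ _ _ _ rfl

theorem CrL.congr {t t' : Lab → ℝ} {l₁ l₂ l₃ l₄ : Lab} {p : ℝ × ℝ} (h : CrL t l₁ l₂ l₃ l₄ p)
    (e₁ : t l₁ = t' l₁) (e₂ : t l₂ = t' l₂) (e₃ : t l₃ = t' l₃) (e₄ : t l₄ = t' l₄) :
    CrL t' l₁ l₂ l₃ l₄ p := by
  obtain ⟨a1, a2, a3, a4, a5, a6, a7, a8, a9, b1, b2, b3, b4⟩ := h
  unfold pt at a8 a9 b1 b2 b3 b4
  rw [e₁] at a8 b1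
  rw [e₂] at a8 b2
  rw [e₃] at a9 b3
  rw [e₄] at a9 b4
  exact ⟨a1, a2, a3, a4, a5, a6, a7, a8, a9, b1, b2, b3, b4⟩

/-- a triple point -/
structure Tri (t : Lab → ℝ) (l₁ l₂ l₃ l₄ l₅ l₆ : Lab) (p : ℝ × ℝ) : Prop where
  c₁ : CrL t l₁ l₂ l₃ l₄ p
  c₂ : CrL t l₁ l₂ l₅ l₆ p
  c₃ : CrL t l₃ l₄ l₅ l₆ p

theorem Tri.flip {t : Lab → ℝ} {l₁ l₂ l₃ l₄ l₅ l₆ : Lab} {p : ℝ × ℝ}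
    (h : Tri t l₁ l₂ l₃ l₄ l₅ l₆ p) : Tri t l₂ l₁ l₃ l₄ l₅ l₆ p :=
  ⟨h.c₁.flip, h.c₂.flip, h.c₃⟩

theorem Tri.swap {t : Lab → ℝ} {l₁ l₂ l₃ l₄ l₅ l₆ : Lab} {p : ℝ × ℝ}
    (h : Tri t l₁ l₂ l₃ l₄ l₅ l₆ p) : Tri t l₃ l₄ l₁ l₂ l₅ l₆ p :=
  ⟨h.c₁.symm, h.c₃, h.c₂⟩

theorem Tri.rot {t : Lab → ℝ} {l₁ l₂ l₃ l₄ l₅ l₆ : Lab} {p : ℝ × ℝ}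
    (h : Tri t l₁ l₂ l₃ l₄ l₅ l₆ p) : Tri t l₅ l₆ l₁ l₂ l₃ l₄ p :=
  ⟨h.c₂.symm, h.c₃.symm, h.c₁⟩

theorem Valid.update {t : Lab → ℝ} (hv : Valid t) (v : Lab) (x : ℝ)
    (h1 : (v.2 : ℝ) / (v.2 + 1) < x) (h2 : x < ((v.2 : ℝ) + 1) / (v.2 + 2)) :
    Valid (Function.update t v x) := by
  constructor
  · intro k i
    by_cases h : (k, i) = v
    · subst h; simpa using h1
    · rw [Function.update_of_ne h]; exact hv.lo k i
  · intro k i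
    by_cases h : (k, i) = v
    · subst h; simpa using h2
    · rw [Function.update_of_ne h]; exact hv.hi k i

theorem bad_subsingleton {t : Lab → ℝ} (hv : Valid t) (v w l₃ l₄ l₅ l₆ : Lab)
    (hm : ¬ IsHub v.1) :
    {x : ℝ | Valid (Function.update t v x) ∧
      ∃ p, Tri (Function.update t v x) v w l₃ l₄ l₅ l₆ p}.Subsingleton := by
  rintro x ⟨vx, p, h⟩ y ⟨vy, q, g⟩
  by_contra hne
  obtain ⟨d3, d4, dw3, dw4⟩ := h.c₁.disj vx
  obtain ⟨d5, d6, dw5, dw6⟩ := h.c₂.disj vx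
  have hw : w ≠ v := fun e => h.c₁.adj.ne (by rw [e])
  have c1 : CrL t l₃ l₄ l₅ l₆ p := by
    apply h.c₃.congr <;> apply Function.update_of_ne <;> apply Ne.symm <;> assumption
  have c2 : CrL t l₃ l₄ l₅ l₆ q := by
    apply g.c₃.congr <;> apply Function.update_of_ne <;> apply Ne.symm <;> assumption
  have hpq := c1.uniq hv c2
  subst hpq
  have s1 := h.c₁.seg
  have s2 := g.c₁.seg
  have s3 := h.c₁.n₂
  simp only [pt, Function.update_self, Function.update_of_ne hw] at s1 s2 s3
  exact s3 (move_ori h.c₁.adj hm hne (hv.pos w) (hv.lt_one w) s1 s2)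

theorem exists_valid : ∃ t, Valid t := by
  refine ⟨fun l => ((l.2 : ℝ) / (l.2 + 1) + (l.2 + 1) / (l.2 + 2)) / 2, ?_, ?_⟩
  all_goals
    intro k i
    have : (i : ℝ) / (i + 1) < (i + 1) / (i + 2) := by
      rw [div_lt_div_iff₀ (by positivity) (by positivity)]; nlinarith
    simp only
    linarith

theorem exists_generic {F : Set Lab} (hF : F.Finite) : ∃ t, Valid t ∧
    ∀ l₁ ∈ F, ∀ l₂ ∈ F, ∀ l₃ ∈ F, ∀ l₄ ∈ F, ∀ l₅ ∈ F, ∀ l₆ ∈ F, ¬ IsHub l₁.1 →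
      ∀ p, ¬ Tri t l₁ l₂ l₃ l₄ l₅ l₆ p := by
  suffices H : ∀ S : Set Lab, S.Finite → ∃ t, Valid t ∧
      ∀ l₁ ∈ F, ∀ l₂ ∈ F, ∀ l₃ ∈ F, ∀ l₄ ∈ F, ∀ l₅ ∈ F, ∀ l₆ ∈ F, l₁ ∈ S → ¬ IsHub l₁.1 →
      ∀ p, ¬ Tri t l₁ l₂ l₃ l₄ l₅ l₆ p by
    obtain ⟨t, hv, h⟩ := H F hF
    exact ⟨t, hv, fun l₁ h1 l₂ h2 l₃ h3 l₄ h4 l₅ h5 l₆ h6 => h l₁ h1 l₂ h2 l₃ h3 l₄ h4 l₅ h5 l₆ h6 h1⟩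
  intro S hS
  induction S, hS using Set.Finite.induction_on with
  | empty =>
    obtain ⟨t, ht⟩ := exists_valid
    exact ⟨t, ht, fun _ _ _ _ _ _ _ _ _ _ _ _ h => absurd h (Set.notMem_empty _)⟩
  | @insert v S hvS hS ih =>
    obtain ⟨t, hv, ht⟩ := ih
    by_cases hm : IsHub v.1
    · refine ⟨t, hv, ?_⟩
      intro l₁ h1 l₂ h2 l₃ h3 l₄ h4 l₅ h5 l₆ h6 hS hub
      refine ht l₁ h1 l₂ h2 l₃ h3 l₄ h4 l₅ h5 l₆ h6 ?_ hub
      rcases hS with rfl | h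
      · exact absurd hm hub
      · exact h
    let Bad : Set ℝ := ⋃ w ∈ F, ⋃ l₃ ∈ F, ⋃ l₄ ∈ F, ⋃ l₅ ∈ F, ⋃ l₆ ∈ F,
      {x : ℝ | Valid (Function.update t v x) ∧
        ∃ p, Tri (Function.update t v x) v w l₃ l₄ l₅ l₆ p}
    have hBad : Bad.Finite :=
      hF.biUnion fun w _ => hF.biUnion fun l₃ _ => hF.biUnion fun l₄ _ => hF.biUnion fun l₅ _ =>
        hF.biUnion fun l₆ _ => (bad_subsingleton hv v w l₃ l₄ l₅ l₆ hm).finite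
    have hlt : (v.2 : ℝ) / (v.2 + 1) < (v.2 + 1) / (v.2 + 2) := by
      rw [div_lt_div_iff₀ (by positivity) (by positivity)]; nlinarith
    obtain ⟨x, hx, hxb⟩ := ((Set.Ioo_infinite hlt).sdiff hBad).nonempty
    have hv' := hv.update v x hx.1 hx.2
    refine ⟨_, hv', ?_⟩
    have key : ∀ w ∈ F, ∀ l₃ ∈ F, ∀ l₄ ∈ F, ∀ l₅ ∈ F, ∀ l₆ ∈ F, ∀ p,
        ¬ Tri (Function.update t v x) v w l₃ l₄ l₅ l₆ p := by
      intro w h2 l₃ h3 l₄ h4 l₅ h5 l₆ h6 p hp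
      apply hxb
      simp only [Bad, Set.mem_iUnion]
      exact ⟨w, h2, l₃, h3, l₄, h4, l₅, h5, l₆, h6, hv', p, hp⟩
    intro l₁ h1 l₂ h2 l₃ h3 l₄ h4 l₅ h5 l₆ h6 hS hub p hp
    by_cases e1 : l₁ = v
    · subst e1; exact key _ h2 _ h3 _ h4 _ h5 _ h6 p hp
    by_cases e2 : l₂ = v
    · subst e2; exact key _ h1 _ h3 _ h4 _ h5 _ h6 p hp.flip
    by_cases e3 : l₃ = v
    · subst e3; exact key _ h4 _ h1 _ h2 _ h5 _ h6 p hp.swap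
    by_cases e4 : l₄ = v
    · subst e4; exact key _ h3 _ h1 _ h2 _ h5 _ h6 p hp.swap.flip
    by_cases e5 : l₅ = v
    · subst e5; exact key _ h6 _ h1 _ h2 _ h3 _ h4 p hp.rot
    by_cases e6 : l₆ = v
    · subst e6; exact key _ h5 _ h1 _ h2 _ h3 _ h4 p hp.rot.flip
    refine ht l₁ h1 l₂ h2 l₃ h3 l₄ h4 l₅ h5 l₆ h6 (hS.resolve_left e1) hub p ⟨?_, ?_, ?_⟩
    · apply hp.c₁.congr <;> apply Function.update_of_ne <;> assumption
    · apply hp.c₂.congr <;> apply Function.update_of_ne <;> assumption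
    · apply hp.c₃.congr <;> apply Function.update_of_ne <;> assumption

/-! ### The drawing -/

/-- A graph labelled by the configuration. -/
structure Lbl {V : Type*} (G : SimpleGraph V) (lab : V → Lab) : Prop where
  inj : Function.Injective lab
  ok : ∀ v, Ok (lab v)
  adj : ∀ u v, G.Adj u v → AdjK (lab u).1 (lab v).1

theorem image_seg (u v p : ℝ × ℝ) :
    p ∈ (fun r : ℝ => ((1 - r) * u.1 + r * v.1, (1 - r) * u.2 + r * v.2)) '' Set.Icc 0 1 ↔
      InSeg p u v := by
  constructor
  · rintro ⟨r, ⟨h0, h1⟩, rfl⟩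
    exact ⟨r, h0, h1, rfl, rfl⟩
  · rintro ⟨r, h0, h1, h2, h3⟩
    exact ⟨r, ⟨h0, h1⟩, Prod.ext h2.symm h3.symm⟩

def draw {V : Type*} {G : SimpleGraph V} {lab : V → Lab} (L : Lbl G lab) {t : Lab → ℝ}
    (hv : Valid t) : Drawing G where
  pos v := pt t (lab v)
  pos_inj u v h := L.inj (pt_inj hv (L.ok u) (L.ok v) h)
  arc u v r := ((1 - r) * (pt t (lab u)).1 + r * (pt t (lab v)).1,
    (1 - r) * (pt t (lab u)).2 + r * (pt t (lab v)).2)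
  arc_cont u v _ := by
    apply Continuous.continuousOn
    fun_prop
  arc_zero u v _ := by simp
  arc_one u v _ := by simp
  arc_symm u v _ r := by
    ext
    · simp only; ring
    · simp only; ring
  arc_avoid u v h c hu hc := by
    rw [image_seg]
    exact avoid_adj hv (L.adj u v h) (L.ok u) (L.ok v) (L.ok c) (fun e => hu (L.inj e))
      (fun e => hc (L.inj e))

section
variable {V : Type*} {G : SimpleGraph V} {lab : V → Lab} (L : Lbl G lab) {t : Lab → ℝ}
    (hv : Valid t)

theorem draw_points {u v : V} {p : ℝ × ℝ} (h : p ∈ (draw L hv).edgePoints s(u, v)) :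
    InSeg p (pt t (lab u)) (pt t (lab v)) := by
  obtain ⟨x, y, he, hadj, hp⟩ := h
  have hp' : InSeg p (pt t (lab x)) (pt t (lab y)) := (image_seg _ _ _).1 hp
  rw [Sym2.eq_iff] at he
  rcases he with ⟨rfl, rfl⟩ | ⟨rfl, rfl⟩
  · exact hp'
  · exact hp'.swap

theorem draw_cross {u v w x : V} {p : ℝ × ℝ}
    (h : (draw L hv).IsCrossing s(u, v) s(w, x) p) :
    CrL t (lab u) (lab v) (lab w) (lab x) p := by
  obtain ⟨h1, h2, hne, h3, h4, h5, h6⟩ := h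
  refine ⟨L.adj _ _ h1, L.adj _ _ h2, L.ok _, L.ok _, L.ok _, L.ok _, ?_, draw_points L hv h3,
    draw_points L hv h4, ?_, ?_, ?_, ?_⟩
  · intro e
    apply hne
    apply Sym2.map.injective L.inj
    simpa using e
  · exact fun e => h5 ⟨u, by simp, e⟩
  · exact fun e => h5 ⟨v, by simp, e⟩
  · exact fun e => h6 ⟨w, by simp, e⟩
  · exact fun e => h6 ⟨x, by simp, e⟩

theorem draw_good (hg : ∀ v₁ v₂ v₃ v₄ v₅ v₆ : V, ¬ IsHub (lab v₁).1 → ∀ p,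
    ¬ Tri t (lab v₁) (lab v₂) (lab v₃) (lab v₄) (lab v₅) (lab v₆) p) : (draw L hv).IsGood where
  arc_inj u v h := by
    intro r _ r' _ e
    by_contra hne
    have hpos : pt t (lab u) ≠ pt t (lab v) :=
      fun e => h.ne (L.inj (pt_inj hv (L.ok u) (L.ok v) e))
    apply hpos
    simp only [draw, Prod.mk.injEq] at e
    have hr : r' - r ≠ 0 := fun h => hne (by linarith)
    ext
    · apply mul_left_cancel₀ hr; linarith [e.1]
    · apply mul_left_cancel₀ hr; linarith [e.2]
  adj_no_cross e f := by
    rintro ⟨c, hc, hc'⟩ p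
    obtain ⟨x, rfl⟩ := hc
    obtain ⟨y, rfl⟩ := hc'
    intro h
    exact ((draw_cross L hv h).disj hv).1 rfl
  cross_once e f := by
    induction e with | h u v
    induction f with | h w x
    intro p hp q hq
    exact (draw_cross L hv hp).uniq hv (draw_cross L hv hq)
  no_triple p e f g := by
    induction e with | h u v
    induction f with | h w x
    induction g with | h y z
    rintro hef heg hfg ⟨h1, h2, h3⟩
    have c1 := draw_cross L hv h1
    have c2 := draw_cross L hv h2
    have c3 := draw_cross L hv h3
    have T : Tri t _ _ _ _ _ _ p := ⟨c1, c3, c2⟩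
    have k1 := fun h => hg _ _ _ _ _ _ h _ T
    have k2 := fun h => hg _ _ _ _ _ _ h _ T.flip
    have k3 := fun h => hg _ _ _ _ _ _ h _ T.swap
    rw [imp_false, not_not] at k1 k2 k3
    have d := c1.disj hv
    have a1 := c1.adj.ne
    have o1 := c1.o₁ k1
    have o2 := c1.o₂ k2
    have o3 := c1.o₃ k3
    revert d a1 o1 o2 o3 k1 k2 k3
    generalize lab u = p1
    generalize lab v = p2
    generalize lab w = p3
    obtain ⟨x1, i1⟩ := p1
    obtain ⟨x2, i2⟩ := p2
    obtain ⟨x3, i3⟩ := p3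
    cases x1 <;> cases x2 <;> cases x3 <;> simp [IsHub] <;> grind

theorem draw_crNum {ι : Type*} [Fintype ι] (g : ι → Sym2 (Sym2 Lab))
    (hg : ∀ v₁ v₂ v₃ v₄ : V, Alw s(s(lab v₁, lab v₂), s(lab v₃, lab v₄)) →
      s(s(lab v₁, lab v₂), s(lab v₃, lab v₄)) ∈ Set.range g)
    (hd : (draw L hv).IsGood) : (draw L hv).crNum ≤ Fintype.card ι := by
  unfold Drawing.crNum Drawing.crBetween
  have hmem : ∀ q : (draw L hv).crossings G.edgeSet G.edgeSet,
      ∃ i, g i = Sym2.map (Sym2.map lab) q.1.2 := by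
    rintro ⟨⟨p, q⟩, e, f, hq, _, _, hc⟩
    simp only at hq hc ⊢
    subst hq
    induction e with | h u v
    induction f with | h w x
    obtain ⟨i, hi⟩ := hg u v w x ((draw_cross L hv hc).out hv).1
    exact ⟨i, by rw [hi]; simp⟩
  choose F hF using hmem
  rw [← Nat.card_eq_fintype_card]
  apply Nat.card_le_card_of_injective F
  rintro ⟨⟨p, q⟩, e, f, hq, _, _, hc⟩ ⟨⟨p', q'⟩, e', f', hq', _, _, hc'⟩ h
  have h' := congrArg g h
  rw [hF, hF] at h'
  have hqq : q = q' := Sym2.map.injective (Sym2.map.injective L.inj) h'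
  subst hqq
  simp only at hq hc hq' hc'
  have : p = p' := by
    rw [hq, Sym2.eq_iff] at hq'
    rcases hq' with ⟨rfl, rfl⟩ | ⟨rfl, rfl⟩
    · exact hd.cross_once _ _ hc hc'
    · refine hd.cross_once _ _ hc ?_
      obtain ⟨a1, a2, a3, a4, a5, a6, a7⟩ := hc'
      exact ⟨a2, a1, a3.symm, a5, a4, a7, a6⟩
  subst this
  rfl

end

theorem crossing_le {V : Type*} [Finite V] {G : SimpleGraph V} {lab : V → Lab} (L : Lbl G lab)
    {ι : Type*} [Fintype ι] (g : ι → Sym2 (Sym2 Lab))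
    (hg : ∀ v₁ v₂ v₃ v₄ : V, Alw s(s(lab v₁, lab v₂), s(lab v₃, lab v₄)) →
      s(s(lab v₁, lab v₂), s(lab v₃, lab v₄)) ∈ Set.range g) :
    crossingNumber G ≤ Fintype.card ι := by
  obtain ⟨t, hv, ht⟩ := exists_generic (Set.finite_range lab)
  have hd := draw_good L hv (fun v₁ v₂ v₃ v₄ v₅ v₆ =>
    ht _ ⟨v₁, rfl⟩ _ ⟨v₂, rfl⟩ _ ⟨v₃, rfl⟩ _ ⟨v₄, rfl⟩ _ ⟨v₅, rfl⟩ _ ⟨v₆, rfl⟩)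
  have h1 : crossingNumber G ≤ (draw L hv).crNum := by
    unfold crossingNumber
    exact Nat.sInf_le ⟨_, hd, rfl⟩
  exact h1.trans (draw_crNum L hv g hg hd)

/-! ### Counting -/

abbrev Tr (x : ℕ) : Type := Σ i : Fin x, Fin i

theorem card_Tr (x : ℕ) : Fintype.card (Tr x) * 2 = x * (x - 1) := by
  rw [Fintype.card_sigma]
  simp only [Fintype.card_fin]
  rw [Fin.sum_univ_eq_sum_range (fun i => i) x, Finset.sum_range_id_mul_two]

abbrev Code (sz : Kd → ℕ) : Type :=
  ((Tr (sz A) × Tr (sz B) ⊕ Tr (sz B) × Tr (sz C)) ⊕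
    (Tr (sz C) × Tr (sz D) ⊕ Tr (sz D) × Tr (sz A))) ⊕
  ((Tr (sz A) × Fin (sz B) ⊕ Tr (sz B) × Fin (sz A)) ⊕
    (Tr (sz C) × Fin (sz D) ⊕ Tr (sz D) × Fin (sz C))) ⊕
  ((Tr (sz B) × Fin (sz C) ⊕ Tr (sz C) × Fin (sz B)) ⊕
    (Tr (sz D) × Fin (sz A) ⊕ Tr (sz A) × Fin (sz D))) ⊕
  (Fin (sz C) × Fin (sz D))

def gS (sz : Kd → ℕ) (X Y : Kd) (q : Tr (sz X) × Tr (sz Y)) : Sym2 (Sym2 Lab) :=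
  s(s((X, (q.1.1 : ℕ)), (Y, (q.2.2 : ℕ))), s((X, (q.1.2 : ℕ)), (Y, (q.2.1 : ℕ))))

def gA (sz : Kd → ℕ) (X Y : Kd) (q : Tr (sz X) × Fin (sz Y)) : Sym2 (Sym2 Lab) :=
  s(s((a, 0), (X, (q.1.1 : ℕ))), s((X, (q.1.2 : ℕ)), (Y, (q.2 : ℕ))))

def gB (sz : Kd → ℕ) (X Y : Kd) (q : Tr (sz X) × Fin (sz Y)) : Sym2 (Sym2 Lab) :=
  s(s((b, 0), (X, (q.1.2 : ℕ))), s((X, (q.1.1 : ℕ)), (Y, (q.2 : ℕ))))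

def gC (sz : Kd → ℕ) (q : Fin (sz C) × Fin (sz D)) : Sym2 (Sym2 Lab) :=
  s(s((a, 0), (b, 0)), s((C, (q.1 : ℕ)), (D, (q.2 : ℕ))))

def code (sz : Kd → ℕ) : Code sz → Sym2 (Sym2 Lab) :=
  Sum.elim (Sum.elim (Sum.elim (gS sz A B) (gS sz B C)) (Sum.elim (gS sz C D) (gS sz D A)))
  (Sum.elim (Sum.elim (Sum.elim (gA sz A B) (gA sz B A)) (Sum.elim (gA sz C D) (gA sz D C)))
  (Sum.elim (Sum.elim (Sum.elim (gB sz B C) (gB sz C B)) (Sum.elim (gB sz D A) (gB sz A D)))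
    (gC sz)))

theorem alw_code (sz : Kd → ℕ) (ha : sz a = 1) (hb : sz b = 1) {q : Sym2 (Sym2 Lab)} (h : Alw q)
    (hq : ∀ e ∈ q, ∀ l ∈ e, l.2 < sz l.1) : q ∈ Set.range (code sz) := by
  cases h with
  | @xxyy X Y h i j k l hij hkl =>
    have hi : i < sz X := hq s((X, i), (Y, l)) (by simp) (X, i) (by simp)
    have hk : k < sz Y := hq s((X, j), (Y, k)) (by simp) (Y, k) (by simp)
    cases h
    · exact ⟨.inl (.inl (.inl (⟨⟨i, hi⟩, ⟨j, hij⟩⟩, ⟨⟨k, hk⟩, ⟨l, hkl⟩⟩))), rfl⟩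
    · exact ⟨.inl (.inl (.inr (⟨⟨i, hi⟩, ⟨j, hij⟩⟩, ⟨⟨k, hk⟩, ⟨l, hkl⟩⟩))), rfl⟩
    · exact ⟨.inl (.inr (.inl (⟨⟨i, hi⟩, ⟨j, hij⟩⟩, ⟨⟨k, hk⟩, ⟨l, hkl⟩⟩))), rfl⟩
    · exact ⟨.inl (.inr (.inr (⟨⟨i, hi⟩, ⟨j, hij⟩⟩, ⟨⟨k, hk⟩, ⟨l, hkl⟩⟩))), rfl⟩
  | @ax X Y h i j k o hij =>
    have ho : o < sz a := hq s((a, o), (X, i)) (by simp) (a, o) (by simp)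
    have hi : i < sz X := hq s((a, o), (X, i)) (by simp) (X, i) (by simp)
    have hk : k < sz Y := hq s((X, j), (Y, k)) (by simp) (Y, k) (by simp)
    obtain rfl : o = 0 := by omega
    cases h
    · exact ⟨.inr (.inl (.inl (.inl (⟨⟨i, hi⟩, ⟨j, hij⟩⟩, ⟨k, hk⟩)))), rfl⟩
    · exact ⟨.inr (.inl (.inl (.inr (⟨⟨i, hi⟩, ⟨j, hij⟩⟩, ⟨k, hk⟩)))), rfl⟩
    · exact ⟨.inr (.inl (.inr (.inl (⟨⟨i, hi⟩, ⟨j, hij⟩⟩, ⟨k, hk⟩)))), rfl⟩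
    · exact ⟨.inr (.inl (.inr (.inr (⟨⟨i, hi⟩, ⟨j, hij⟩⟩, ⟨k, hk⟩)))), rfl⟩
  | @bx X Y h i j k o hij =>
    have ho : o < sz b := hq s((b, o), (X, j)) (by simp) (b, o) (by simp)
    have hi : i < sz X := hq s((X, i), (Y, k)) (by simp) (X, i) (by simp)
    have hk : k < sz Y := hq s((X, i), (Y, k)) (by simp) (Y, k) (by simp)
    obtain rfl : o = 0 := by omega
    cases h
    · exact ⟨.inr (.inr (.inl (.inl (.inl (⟨⟨i, hi⟩, ⟨j, hij⟩⟩, ⟨k, hk⟩))))), rfl⟩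
    · exact ⟨.inr (.inr (.inl (.inl (.inr (⟨⟨i, hi⟩, ⟨j, hij⟩⟩, ⟨k, hk⟩))))), rfl⟩
    · exact ⟨.inr (.inr (.inl (.inr (.inl (⟨⟨i, hi⟩, ⟨j, hij⟩⟩, ⟨k, hk⟩))))), rfl⟩
    · exact ⟨.inr (.inr (.inl (.inr (.inr (⟨⟨i, hi⟩, ⟨j, hij⟩⟩, ⟨k, hk⟩))))), rfl⟩
  | @ab o o' k l =>
    have ho : o < sz a := hq s((a, o), (b, o')) (by simp) (a, o) (by simp)
    have ho' : o' < sz b := hq s((a, o), (b, o')) (by simp) (b, o') (by simp)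
    have hk : k < sz C := hq s((C, k), (D, l)) (by simp) (C, k) (by simp)
    have hl : l < sz D := hq s((C, k), (D, l)) (by simp) (D, l) (by simp)
    obtain rfl : o = 0 := by omega
    obtain rfl : o' = 0 := by omega
    exact ⟨.inr (.inr (.inr (⟨k, hk⟩, ⟨l, hl⟩))), rfl⟩

theorem card_Code (sz : Kd → ℕ) : Fintype.card (Code sz) =
    (Fintype.card (Tr (sz A)) + Fintype.card (Tr (sz C))) *
      (Fintype.card (Tr (sz B)) + Fintype.card (Tr (sz D))) +
    (Fintype.card (Tr (sz A)) + Fintype.card (Tr (sz C))) * (sz B + sz D) +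
    (Fintype.card (Tr (sz B)) + Fintype.card (Tr (sz D))) * (sz A + sz C) + sz C * sz D := by
  simp only [Code, Fintype.card_sum, Fintype.card_prod, Fintype.card_fin]
  ring

theorem card_half (m : ℕ) :
    Fintype.card (Tr (m - m / 2)) + Fintype.card (Tr (m / 2)) + m = (m + 2) / 2 * ((m + 1) / 2) := by
  have h1 := card_Tr (m - m / 2)
  have h2 := card_Tr (m / 2)
  generalize Fintype.card (Tr (m - m / 2)) = x at h1 ⊢
  generalize Fintype.card (Tr (m / 2)) = y at h2 ⊢
  obtain ⟨p, rfl | rfl⟩ := Nat.even_or_odd' m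
  · have e1 : 2 * p / 2 = p := by omega
    have e2 : 2 * p - p = p := by omega
    have e3 : (2 * p + 2) / 2 = p + 1 := by omega
    have e4 : (2 * p + 1) / 2 = p := by omega
    rw [e1, e2] at h1
    rw [e1] at h2
    rw [e3, e4]
    cases p with
    | zero => simp at *; omega
    | succ r => simp at h1 h2; nlinarith
  · have e1 : (2 * p + 1) / 2 = p := by omega
    have e2 : 2 * p + 1 - p = p + 1 := by omega
    have e3 : (2 * p + 1 + 2) / 2 = p + 1 := by omega
    have e4 : (2 * p + 1 + 1) / 2 = p + 1 := by omega
    rw [e1, e2] at h1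
    rw [e1] at h2
    rw [e3, e4]
    cases p with
    | zero => simp at *; omega
    | succ r => simp at h1 h2; nlinarith

def size (m n : ℕ) : Kd → ℕ
  | a => 1
  | b => 1
  | A => m - m / 2
  | B => n - n / 2
  | C => m / 2
  | D => n / 2

theorem card_size (m n : ℕ) : (Fintype.card (Code (size m n)) : ℤ) =
    (Z (m + 2) (n + 2) : ℤ) - (m : ℤ) * n + ((m / 2 : ℕ) : ℤ) * ((n / 2 : ℕ) : ℤ) := by
  have h0 : Fintype.card (Code (size m n)) =
      (Fintype.card (Tr (m - m / 2)) + Fintype.card (Tr (m / 2))) *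
        (Fintype.card (Tr (n - n / 2)) + Fintype.card (Tr (n / 2))) +
      (Fintype.card (Tr (m - m / 2)) + Fintype.card (Tr (m / 2))) * (n - n / 2 + n / 2) +
      (Fintype.card (Tr (n - n / 2)) + Fintype.card (Tr (n / 2))) * (m - m / 2 + m / 2) +
      m / 2 * (n / 2) := card_Code (size m n)
  rw [h0]
  have h1 := card_half m
  have h2 := card_half n
  have e1 : m - m / 2 + m / 2 = m := by omega
  have e2 : n - n / 2 + n / 2 = n := by omega
  have hZ : Z (m + 2) (n + 2) = ((m + 2) / 2 * ((m + 1) / 2)) * ((n + 2) / 2 * ((n + 1) / 2)) := by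
    unfold Z
    have : m + 2 - 1 = m + 1 := rfl
    have : n + 2 - 1 = n + 1 := rfl
    simp only [*]
    ring
  rw [hZ, ← h1, ← h2, e1, e2]
  push_cast
  ring

/-! ### Labelling of the complete four-partite graph -/

def half (X Y : Kd) (m i : ℕ) : Lab :=
  if i < m - m / 2 then (X, i) else (Y, i - (m - m / 2))

theorem half_cases (X Y : Kd) (m i : ℕ) (hi : i < m) :
    (half X Y m i = (X, i) ∧ i < m - m / 2) ∨
      ∃ j, half X Y m i = (Y, j) ∧ j < m / 2 ∧ i = j + (m - m / 2) := by
  unfold half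
  split_ifs with h
  · exact Or.inl ⟨rfl, h⟩
  · exact Or.inr ⟨_, rfl, by omega, by omega⟩

def labK (m n : ℕ) : (Σ i : Fin 4, ![Fin 1, Fin 1, Fin m, Fin n] i) → Lab
  | ⟨0, _⟩ => (a, 0)
  | ⟨1, _⟩ => (b, 0)
  | ⟨2, i⟩ => half A C m (i : Fin m).val
  | ⟨3, j⟩ => half B D n (j : Fin n).val

theorem labK_size (m n : ℕ) (v) : (labK m n v).2 < size m n (labK m n v).1 := by
  obtain ⟨k, i⟩ := v
  fin_cases k
  · exact Nat.one_pos
  · exact Nat.one_pos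
  · change (half A C m (i : Fin m).val).2 < size m n (half A C m (i : Fin m).val).1
    rcases half_cases A C m _ (i : Fin m).isLt with ⟨h, h'⟩ | ⟨j, h, h', _⟩ <;> rw [h] <;> exact h'
  · change (half B D n (i : Fin n).val).2 < size m n (half B D n (i : Fin n).val).1
    rcases half_cases B D n _ (i : Fin n).isLt with ⟨h, h'⟩ | ⟨j, h, h', _⟩ <;> rw [h] <;> exact h'

/-- the part of a kind -/
def part : Kd → Fin 4
  | a => 0
  | b => 1
  | A => 2
  | B => 3
  | C => 2
  | D => 3

theorem part_half (X Y : Kd) (h : part X = part Y) (m i : ℕ) : part (half X Y m i).1 = part X := by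
  unfold half
  split_ifs
  · rfl
  · exact h.symm

theorem labK_part (m n : ℕ) (v) : part (labK m n v).1 = v.1 := by
  obtain ⟨k, i⟩ := v
  fin_cases k
  · rfl
  · rfl
  · exact part_half A C rfl m _
  · exact part_half B D rfl n _

theorem adjK_of_part {k l : Kd} (h : part k ≠ part l) : AdjK k l := by
  cases k <;> cases l <;> first
  | exact absurd rfl h
  | (left; constructor)
  | (right; constructor)

theorem half_inj {X Y : Kd} (h : X ≠ Y) {m i j : ℕ} (hi : i < m) (hj : j < m)
    (e : half X Y m i = half X Y m j) : i = j := by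
  rcases half_cases X Y m i hi with ⟨h1, _⟩ | ⟨i', h1, _, h2⟩ <;>
  rcases half_cases X Y m j hj with ⟨g1, _⟩ | ⟨j', g1, _, g2⟩ <;>
  rw [h1, g1, Prod.mk.injEq] at e
  · exact e.2
  · exact absurd e.1 h
  · exact absurd e.1.symm h
  · omega

theorem labK_lbl (m n : ℕ) : Lbl (quadK 1 1 m n) (labK m n) where
  inj := by
    rintro ⟨k, i⟩ ⟨l, j⟩ e
    have hk : k = l := by
      have := congrArg (fun x => part x.1) e
      simpa only [labK_part] using this
    subst hk
    congr 1
    fin_cases k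
    · exact Subsingleton.elim (α := Fin 1) i j
    · exact Subsingleton.elim (α := Fin 1) i j
    · exact Fin.ext (half_inj (by intro h; cases h) (i : Fin m).isLt (j : Fin m).isLt e)
    · exact Fin.ext (half_inj (by intro h; cases h) (i : Fin n).isLt (j : Fin n).isLt e)
  ok v := by
    intro h
    have := labK_size m n v
    revert h this
    generalize labK m n v = l
    obtain ⟨k, i⟩ := l
    cases k <;> simp [IsHub, size]
  adj u v h := by
    apply adjK_of_part
    rw [labK_part, labK_part]
    exact h

theorem final (m n : ℕ) : crossingNumber (quadK 1 1 m n) ≤ Fintype.card (Code (size m n)) := by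
  have : Finite (Σ i : Fin 4, ![Fin 1, Fin 1, Fin m, Fin n] i) := by
    have : ∀ i : Fin 4, Finite (![Fin 1, Fin 1, Fin m, Fin n] i) := by
      intro i
      fin_cases i
      · exact inferInstanceAs (Finite (Fin 1))
      · exact inferInstanceAs (Finite (Fin 1))
      · exact inferInstanceAs (Finite (Fin m))
      · exact inferInstanceAs (Finite (Fin n))
    infer_instance
  refine crossing_le (labK_lbl m n) (code (size m n)) ?_
  intro v₁ v₂ v₃ v₄ h
  refine alw_code _ rfl rfl h ?_
  intro e he l hl
  rw [Sym2.mem_iff] at he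
  rcases he with rfl | rfl <;> rw [Sym2.mem_iff] at hl <;> rcases hl with rfl | rfl <;>
    exact labK_size m n _

end RectDraw

/-- For all positive integers `m` and `n`,
`cr(K_{1,1,m,n}) ≤ Z(m+2,n+2) − mn + ⌊m/2⌋⌊n/2⌋`. -/
theorem statement15 (m n : ℕ) (hm : 0 < m) (hn : 0 < n) :
    (crossingNumber (quadK 1 1 m n) : ℤ) ≤
      (Z (m + 2) (n + 2) : ℤ) - (m : ℤ) * n + ((m / 2 : ℕ) : ℤ) * ((n / 2 : ℕ) : ℤ) := by
  rw [← RectDraw.card_size m n]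
  exact_mod_cast RectDraw.final m n
end

section
/- For all positive integers m and n, the crossing number of the complete bipartite graph satisfies cr(K_{m,n}) ≤ Z(m,n). -/
open SimpleGraph

variable {V : Type*}

namespace Zar

/-- Inverse coordinates of the vertices on the axes. -/
noncomputable def w (i : ℕ) : ℝ := (-2) ^ i

lemma w_ne (i : ℕ) : w i ≠ 0 := by unfold w; positivity

lemma abs_w (i : ℕ) : |w i| = 2 ^ i := by simp [w, abs_pow]

lemma w_inj {i k : ℕ} (h : w i = w k) : i = k := by
  have h2 : |w i| = |w k| := by rw [h]
  rw [abs_w, abs_w] at h2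
  exact pow_right_injective₀ (by norm_num : (0:ℝ) < 2) (by norm_num) h2

lemma w_mul {i : ℕ} {x : ℝ} (h : 0 < w i * x) : w i * x = 2 ^ i * |x| := by
  rw [← abs_w, ← abs_mul, abs_of_pos h]

lemma w_parity {i k : ℕ} {x : ℝ} (h : 0 < w i * x) (h' : 0 < w k * x) : i % 2 = k % 2 := by
  have h3 : 0 < (w i * x) * (w k * x) := mul_pos h h'
  have h4 : (w i * x) * (w k * x) = (-2) ^ (i + k) * x ^ 2 := by unfold w; ring
  by_contra hne
  have hodd : Odd (i + k) := by rw [Nat.odd_iff]; omega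
  have h5 : (-2 : ℝ) ^ (i + k) < 0 := hodd.pow_neg (by norm_num)
  rw [h4] at h3
  nlinarith [sq_nonneg x]

/-- The point `p` lies on the segment number `(i,j)`. -/
def On (i j : ℕ) (p : ℝ × ℝ) : Prop :=
  0 ≤ w i * p.1 ∧ 0 ≤ w j * p.2 ∧ w i * p.1 + w j * p.2 = 1

/-- Placement of the vertices. -/
noncomputable def pos (m n : ℕ) : Fin m ⊕ Fin n → ℝ × ℝ
  | .inl i => ((w i)⁻¹, 0)
  | .inr j => (0, (w j)⁻¹)

lemma pos_inj (m n : ℕ) : Function.Injective (pos m n) := by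
  rintro (a | a) (b | b) h
  · simp only [pos, Prod.mk.injEq, inv_inj, and_true] at h
    rw [Fin.ext (w_inj h)]
  · simp [pos, w_ne] at h
  · simp [pos, w_ne] at h
  · simp only [pos, Prod.mk.injEq, inv_inj, true_and] at h
    rw [Fin.ext (w_inj h)]

lemma on_of_mem {m n : ℕ} {a b : Fin m ⊕ Fin n} (hab : (bipK m n).Adj a b) {p : ℝ × ℝ}
    (hp : p ∈ (fun t : ℝ => (1 - t) • pos m n a + t • pos m n b) '' Set.Icc 0 1) :
    ∃ (i : Fin m) (j : Fin n), ((a = .inl i ∧ b = .inr j) ∨ (a = .inr j ∧ b = .inl i)) ∧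
      On i j p := by
  obtain ⟨t, ⟨h0, h1⟩, rfl⟩ := hp
  rcases a with a | a <;> rcases b with b | b
  · simp at hab
  · refine ⟨a, b, Or.inl ⟨rfl, rfl⟩, ?_⟩
    have := w_ne a
    have := w_ne b
    simp only [On, pos, Prod.smul_mk, Prod.mk_add_mk, smul_eq_mul, mul_zero, add_zero, zero_add]
    have e1 : w a * ((1 - t) * (w a)⁻¹) = 1 - t := by field_simp
    have e2 : w b * (t * (w b)⁻¹) = t := by field_simp
    rw [e1, e2]
    exact ⟨by linarith, h0, by ring⟩
  · refine ⟨b, a, Or.inr ⟨rfl, rfl⟩, ?_⟩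
    have := w_ne a
    have := w_ne b
    simp only [On, pos, Prod.smul_mk, Prod.mk_add_mk, smul_eq_mul, mul_zero, add_zero, zero_add]
    have e1 : w a * ((1 - t) * (w a)⁻¹) = 1 - t := by field_simp
    have e2 : w b * (t * (w b)⁻¹) = t := by field_simp
    rw [e1, e2]
    exact ⟨h0, by linarith, by ring⟩
  · simp at hab

/-- Zarankiewicz's straight line drawing. -/
noncomputable def D (m n : ℕ) : Drawing (bipK m n) where
  pos := pos m n
  pos_inj := pos_inj m n
  arc := fun a b t => (1 - t) • pos m n a + t • pos m n b
  arc_cont := by intro a b _; fun_prop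
  arc_zero := by intro a b _; simp
  arc_one := by intro a b _; simp
  arc_symm := by intro a b _ t; rw [sub_sub_cancel, add_comm]
  arc_avoid := by
    intro a b hab c hca hcb hc
    obtain ⟨i, j, h, h1, h2, h3⟩ := on_of_mem hab hc
    rcases c with c | c
    · simp only [pos, mul_zero, add_zero] at h3
      have : w i = w c := by
        have := w_ne c
        field_simp at h3
        exact h3
      have := Fin.ext (w_inj this)
      subst this
      rcases h with h | h <;> simp_all
    · simp only [pos, mul_zero, zero_add] at h3
      have : w j = w c := by
        have := w_ne c
        field_simp at h3
        exact h3
      have := Fin.ext (w_inj this)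
      subst this
      rcases h with h | h <;> simp_all

lemma edge_on {m n : ℕ} {e : Sym2 (Fin m ⊕ Fin n)} {p : ℝ × ℝ}
    (hp : p ∈ (D m n).edgePoints e) (hp' : p ∉ (D m n).ends e) :
    ∃ (i : Fin m) (j : Fin n), e = s(.inl i, .inr j) ∧
      0 < w i * p.1 ∧ 0 < w j * p.2 ∧ w i * p.1 + w j * p.2 = 1 := by
  obtain ⟨a, b, rfl, hab, hp⟩ := hp
  obtain ⟨i, j, h, h1, h2, h3⟩ := on_of_mem hab hp
  have he : s(a, b) = s(Sum.inl i, Sum.inr j) := by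
    rcases h with ⟨rfl, rfl⟩ | ⟨rfl, rfl⟩
    · rfl
    · exact Sym2.eq_swap
  rw [he] at hp' ⊢
  refine ⟨i, j, rfl, lt_of_le_of_ne h1 ?_, lt_of_le_of_ne h2 ?_, h3⟩
  · intro h0
    apply hp'
    refine ⟨.inr j, by simp, ?_⟩
    have hx : p.1 = 0 := by simpa [w_ne] using h0.symm
    have hy : p.2 = (w j)⁻¹ := by
      rw [hx] at h3
      exact eq_inv_of_mul_eq_one_right (by linarith)
    exact Prod.ext hx hy
  · intro h0
    apply hp'
    refine ⟨.inl i, by simp, ?_⟩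
    have hx : p.2 = 0 := by simpa [w_ne] using h0.symm
    have hy : p.1 = (w i)⁻¹ := by
      rw [hx] at h3
      exact eq_inv_of_mul_eq_one_right (by linarith)
    exact Prod.ext hy hx

lemma pow_lt {i k : ℕ} (h : i < k) : (2:ℝ) * 2 ^ i ≤ 2 ^ k := by
  rw [← pow_succ']
  exact pow_le_pow_right₀ (by norm_num) h

lemma order {i j i' j' : ℕ} {X Y : ℝ} (hX : 0 < X) (hY : 0 < Y)
    (h : 2 ^ i * X + 2 ^ j * Y = 1) (h' : 2 ^ i' * X + 2 ^ j' * Y = 1) (hi : i < i') :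
    j' < j := by
  by_contra hj
  have h1 : (2:ℝ) ^ j ≤ 2 ^ j' := pow_le_pow_right₀ (by norm_num) (not_lt.mp hj)
  have h2 : (2:ℝ) ^ i < 2 ^ i' := pow_lt_pow_right₀ (by norm_num) hi
  have h3 := mul_le_mul_of_nonneg_right h1 hY.le
  have h4 := mul_lt_mul_of_pos_right h2 hX
  linarith

lemma no_three {i₁ j₁ i₂ j₂ i₃ j₃ : ℕ} {X Y : ℝ} (hX : 0 < X) (hY : 0 < Y)
    (h1 : 2 ^ i₁ * X + 2 ^ j₁ * Y = 1) (h2 : 2 ^ i₂ * X + 2 ^ j₂ * Y = 1)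
    (h3 : 2 ^ i₃ * X + 2 ^ j₃ * Y = 1) (h12 : i₁ < i₂) (h23 : i₂ < i₃) : False := by
  have a := mul_le_mul_of_nonneg_right (pow_lt h23) hX.le
  have b := mul_le_mul_of_nonneg_right (pow_lt (order hX hY h1 h2 h12)) hY.le
  have c : 0 < (2:ℝ) ^ i₁ * X := by positivity
  have d : 0 < (2:ℝ) ^ j₃ * Y := by positivity
  linarith

lemma solve {i j i' j' : ℕ} (hi : i < i') (hj : j' < j) {x y : ℝ}
    (h : w i * x + w j * y = 1) (h' : w i' * x + w j' * y = 1) :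
    x = (w j' - w j) / (w i * w j' - w i' * w j) ∧
    y = (w i - w i') / (w i * w j' - w i' * w j) := by
  have hd : w i * w j' - w i' * w j ≠ 0 := by
    intro h0
    have h1 : w (i + j') = w (i' + j) := by
      simp only [w, pow_add] at h0 ⊢
      linarith
    have := w_inj h1
    omega
  constructor
  · rw [eq_div_iff hd]
    linear_combination w j' * h - w j * h'
  · rw [eq_div_iff hd]
    linear_combination w i * h' - w i' * h

lemma cross {m n : ℕ} {e f : Sym2 (Fin m ⊕ Fin n)} {p : ℝ × ℝ}
    (h : (D m n).IsCrossing e f p) :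
    ∃ (i i' : Fin m) (j j' : Fin n), e = s(.inl i, .inr j) ∧ f = s(.inl i', .inr j') ∧
      0 < |p.1| ∧ 0 < |p.2| ∧
      2 ^ (i : ℕ) * |p.1| + 2 ^ (j : ℕ) * |p.2| = 1 ∧
      2 ^ (i' : ℕ) * |p.1| + 2 ^ (j' : ℕ) * |p.2| = 1 ∧
      w i * p.1 + w j * p.2 = 1 ∧ w i' * p.1 + w j' * p.2 = 1 ∧
      (i : ℕ) % 2 = (i' : ℕ) % 2 ∧ (j : ℕ) % 2 = (j' : ℕ) % 2 ∧
      ((i < i' ∧ j' < j) ∨ (i' < i ∧ j < j')) := by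
  obtain ⟨-, -, hne, he, hf, he', hf'⟩ := h
  obtain ⟨i, j, rfl, a1, a2, a3⟩ := edge_on he he'
  obtain ⟨i', j', rfl, b1, b2, b3⟩ := edge_on hf hf'
  have hx : p.1 ≠ 0 := by intro h; simp [h] at a1
  have hy : p.2 ≠ 0 := by intro h; simp [h] at a2
  have hX := abs_pos.mpr hx
  have hY := abs_pos.mpr hy
  have a4 := a3
  have b4 := b3
  rw [w_mul a1, w_mul a2] at a4
  rw [w_mul b1, w_mul b2] at b4
  refine ⟨i, i', j, j', rfl, rfl, hX, hY, a4, b4, a3, b3, w_parity a1 b1, w_parity a2 b2, ?_⟩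
  rcases lt_trichotomy i i' with hi | hi | hi
  · exact Or.inl ⟨hi, order hX hY a4 b4 hi⟩
  · exfalso
    subst hi
    have : w j = w j' := by
      have : w j * p.2 = w j' * p.2 := by linarith
      exact mul_right_cancel₀ hy this
    have := Fin.ext (w_inj this)
    subst this
    exact hne rfl
  · exact Or.inr ⟨hi, order hX hY b4 a4 hi⟩

lemma edge_eq {m n : ℕ} {i i' : Fin m} {j j' : Fin n}
    (h : (s(.inl i, .inr j) : Sym2 (Fin m ⊕ Fin n)) = s(.inl i', .inr j')) :
    i = i' ∧ j = j' := by
  simpa using h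

lemma good (m n : ℕ) : (D m n).IsGood where
  arc_inj := by
    intro a b hab s _ t _ hst
    have hne : pos m n b - pos m n a ≠ 0 :=
      sub_ne_zero.mpr fun h => hab.ne (pos_inj m n h).symm
    have h : (1 - s) • pos m n a + s • pos m n b = (1 - t) • pos m n a + t • pos m n b := hst
    have h2 : (s - t) • (pos m n b - pos m n a) = 0 := by
      have h3 := sub_eq_zero.mpr h
      rw [← h3]
      module
    rcases smul_eq_zero.mp h2 with h4 | h4
    · linarith
    · exact absurd h4 hne
  adj_no_cross := by
    rintro e f ⟨a, hae, haf⟩ p hp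
    obtain ⟨i, i', j, j', rfl, rfl, -, -, -, -, -, -, -, -, h⟩ := cross hp
    rcases a with a | a
    · simp at hae haf
      subst hae haf
      rcases h with h | h <;> exact lt_irrefl _ h.1
    · simp at hae haf
      subst hae haf
      rcases h with h | h <;> exact lt_irrefl _ h.2
  cross_once := by
    intro e f p hp q hq
    obtain ⟨i, i', j, j', rfl, rfl, -, -, -, -, a, b, -, -, h⟩ := cross hp
    obtain ⟨k, k', l, l', he, hf, -, -, -, -, c, d, -, -, -⟩ := cross hq
    obtain ⟨rfl, rfl⟩ := edge_eq he
    obtain ⟨rfl, rfl⟩ := edge_eq hf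
    rcases h with ⟨h1, h2⟩ | ⟨h1, h2⟩
    · have s1 := solve h1 h2 a b
      have s2 := solve h1 h2 c d
      exact Prod.ext (s1.1.trans s2.1.symm) (s1.2.trans s2.2.symm)
    · have s1 := solve h1 h2 b a
      have s2 := solve h1 h2 d c
      exact Prod.ext (s1.1.trans s2.1.symm) (s1.2.trans s2.2.symm)
  no_triple := by
    rintro p e f g - - - ⟨h1, h2, h3⟩
    obtain ⟨i, i', j, j', rfl, rfl, hX, hY, a, b, -, -, -, -, h⟩ := cross h1
    obtain ⟨k, k', l, l', he, rfl, -, -, -, d, -, -, -, -, h'⟩ := cross h2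
    obtain ⟨rfl, rfl⟩ := edge_eq he
    obtain ⟨o, o', q, q', he, hf, -, -, -, -, -, -, -, -, h''⟩ := cross h3
    obtain ⟨rfl, rfl⟩ := edge_eq he
    obtain ⟨rfl, rfl⟩ := edge_eq hf
    rcases h with ⟨h, -⟩ | ⟨h, -⟩ <;> rcases h' with ⟨h', -⟩ | ⟨h', -⟩ <;>
      rcases h'' with ⟨h'', -⟩ | ⟨h'', -⟩
    · exact no_three hX hY a b d h h'
    · exact absurd (h.trans h') h''.not_gt
    · exact no_three hX hY a d b h'' h'
    · exact no_three hX hY d a b h'' h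
    · exact no_three hX hY b a d h h''
    · exact no_three hX hY b d a h' h''
    · exact absurd (h'.trans h) h''.not_gt
    · exact no_three (X := |p.1|) (Y := |p.2|) hX hY d b a h' h

def P (m : ℕ) : Finset (Fin m × Fin m) :=
  Finset.univ.filter fun x => x.1 < x.2 ∧ (x.1 : ℕ) % 2 = (x.2 : ℕ) % 2

lemma sum_half (m : ℕ) : ∑ k ∈ Finset.range m, k / 2 = m / 2 * ((m - 1) / 2) := by
  induction m with
  | zero => rfl
  | succ m ih =>
    rw [Finset.sum_range_succ, ih]
    obtain ⟨k, rfl | rfl⟩ := Nat.even_or_odd' m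
    · rcases k with _ | k
      · rfl
      · have e1 : 2 * (k + 1) / 2 = k + 1 := by omega
        have e2 : (2 * (k + 1) - 1) / 2 = k := by omega
        have e3 : (2 * (k + 1) + 1) / 2 = k + 1 := by omega
        have e4 : (2 * (k + 1) + 1 - 1) / 2 = k + 1 := by omega
        rw [e1, e2, e3, e4]; ring
    · have e1 : (2 * k + 1) / 2 = k := by omega
      have e2 : (2 * k + 1 - 1) / 2 = k := by omega
      have e3 : (2 * k + 1 + 1) / 2 = k + 1 := by omega
      have e4 : (2 * k + 1 + 1 - 1) / 2 = k := by omega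
      rw [e1, e2, e3, e4]; ring

lemma card_P (m : ℕ) : (P m).card ≤ m / 2 * ((m - 1) / 2) := by
  rw [← sum_half]
  have : ((Finset.range m).sigma fun k => Finset.range (k / 2)).card
      = ∑ k ∈ Finset.range m, k / 2 := by simp
  rw [← this]
  apply Finset.card_le_card_of_injOn
    (fun x => (⟨(x.2 : ℕ), (x.1 : ℕ) / 2⟩ : (_ : ℕ) × ℕ))
  · rintro ⟨a, b⟩ h
    simp only [P, Finset.coe_filter, Finset.mem_univ, true_and, Set.mem_ofPred_eq, Fin.lt_def] at h
    simp only [Finset.coe_sigma, Set.mem_sigma_iff, Finset.mem_coe, Finset.mem_range]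
    exact ⟨b.2, by omega⟩
  · rintro ⟨a, b⟩ h ⟨c, d⟩ h' heq
    simp only [P, Finset.coe_filter, Finset.mem_univ, true_and, Set.mem_ofPred_eq, Fin.lt_def]
      at h h'
    simp only [Sigma.mk.injEq, heq_eq_eq] at heq
    ext <;> simp only <;> omega

/-- The crossing attached to two pairs of indices. -/
noncomputable def F (m n : ℕ) (x : (Fin m × Fin m) × (Fin n × Fin n)) :
    (ℝ × ℝ) × Sym2 (Sym2 (Fin m ⊕ Fin n)) :=
  (((w x.2.1 - w x.2.2) / (w x.1.1 * w x.2.1 - w x.1.2 * w x.2.2),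
    (w x.1.1 - w x.1.2) / (w x.1.1 * w x.2.1 - w x.1.2 * w x.2.2)),
    s(s(.inl x.1.1, .inr x.2.2), s(.inl x.1.2, .inr x.2.1)))

lemma crossings_sub (m n : ℕ) (A B : Set (Sym2 (Fin m ⊕ Fin n))) :
    (D m n).crossings A B ⊆ F m n '' (P m ×ˢ P n : Finset _) := by
  rintro ⟨p, q⟩ ⟨e, f, hq, -, -, hc⟩
  simp only at hq hc
  obtain ⟨i, i', j, j', rfl, rfl, -, -, -, -, a, b, c, d, h⟩ := cross hc
  subst hq
  rcases h with ⟨h1, h2⟩ | ⟨h1, h2⟩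
  · have s1 := solve h1 h2 a b
    refine ⟨((i, i'), (j', j)), by simp [P, *], ?_⟩
    exact Prod.ext (Prod.ext s1.1.symm s1.2.symm) rfl
  · have s1 := solve h1 h2 b a
    refine ⟨((i', i), (j, j')), by simp [P, *], ?_⟩
    exact Prod.ext (Prod.ext s1.1.symm s1.2.symm) Sym2.eq_swap

lemma crNum_le (m n : ℕ) : (D m n).crNum ≤ Z m n := by
  unfold Drawing.crNum Drawing.crBetween
  rw [Nat.card_coe_set_eq]
  calc _ ≤ (F m n '' (P m ×ˢ P n : Finset _)).ncard :=
        Set.ncard_le_ncard (crossings_sub m n _ _) ((Finset.finite_toSet _).image _)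
    _ ≤ (↑(P m ×ˢ P n) : Set ((Fin m × Fin m) × (Fin n × Fin n))).ncard := Set.ncard_image_le (Finset.finite_toSet _)
    _ = (P m).card * (P n).card := by rw [Set.ncard_coe_finset, Finset.card_product]
    _ ≤ (m / 2 * ((m - 1) / 2)) * (n / 2 * ((n - 1) / 2)) :=
        Nat.mul_le_mul (card_P m) (card_P n)
    _ = Z m n := by unfold Z; ring

end Zar

/-- For all positive integers `m` and `n`, `cr(K_{m,n}) ≤ Z(m,n)`. -/
theorem statement17 (m n : ℕ) (hm : 0 < m) (hn : 0 < n) :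
    crossingNumber (bipK m n) ≤ Z m n := by
  have h : crossingNumber (bipK m n) ≤ (Zar.D m n).crNum :=
    Nat.sInf_le ⟨Zar.D m n, Zar.good m n, rfl⟩
  exact h.trans (Zar.crNum_le m n)
end
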